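/- arXiv:2111.11266 — 11 statements merged into one kernel-verified Lean document; each statement's English description precedes it below -/
import Mathlib

section
/- Let (H,β) be a real symplectic space and α a compatible real scalar product on H, i.e. β(h,k)² ≤ α(h,h)·α(k,k) for all h,k ∈ H. Then (existence) there exists a one-particle structure (ℋ,κ) on H associated with α, and (uniqueness) if (ℋ,κ) and (ℋ',κ') are two one-particle structures on H associated with α, there exists a complex-linear unitary U : ℋ → ℋ' such that U∘κ = κ'. -/
/-!
Statement 0: existence and uniqueness (up to a complex-linear unitary) of the
one-particle structure `(ℋ, κ)` on a real symplectic space `(H, β)` associated with a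
compatible real scalar product `α`.
-/

open scoped InnerProductSpace

noncomputable section

/-- `(ℋ, κ)` is a one-particle structure on `(H, β)` associated with `α`:
`κ` is real-linear, `Re ⟪κ h, κ k⟫ = α h k`, `Im ⟪κ h, κ k⟫ = β h k`, and
`κ(H) + i κ(H)` is dense in `ℋ`. -/
def IsOneParticle {H : Type} [AddCommGroup H] [Module ℝ H] (α β : H → H → ℝ)
    {ℋ : Type} [NormedAddCommGroup ℋ] [InnerProductSpace ℂ ℋ] [CompleteSpace ℋ]
    (κ : H →ₗ[ℝ] ℋ) : Prop :=
  (∀ h k : H, (⟪κ h, κ k⟫_ℂ).re = α h k) ∧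
  (∀ h k : H, (⟪κ h, κ k⟫_ℂ).im = β h k) ∧
  Dense {z : ℋ | ∃ a b : H, z = κ a + Complex.I • κ b}

/-- The complexification of a real vector space, as pairs `(a, b) = a + i b`. -/
def CxPair (H : Type) : Type := H × H

/-- The pair `a + i b`. -/
def cxMk {H : Type} (a b : H) : CxPair H := (a, b)

instance (H : Type) [AddCommGroup H] : AddCommGroup (CxPair H) :=
  inferInstanceAs (AddCommGroup (H × H))

instance cxModule (H : Type) [AddCommGroup H] [Module ℝ H] : Module ℂ (CxPair H) where
  smul z x := ((z.re • x.1 - z.im • x.2, z.re • x.2 + z.im • x.1) : H × H)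
  one_smul x := by
    refine Prod.ext ?_ ?_
    · change (1 : ℂ).re • x.1 - (1 : ℂ).im • x.2 = x.1
      simp
    · change (1 : ℂ).re • x.2 + (1 : ℂ).im • x.1 = x.2
      simp
  mul_smul z w x := by
    refine Prod.ext ?_ ?_
    · change (z * w).re • x.1 - (z * w).im • x.2
        = z.re • (w.re • x.1 - w.im • x.2) - z.im • (w.re • x.2 + w.im • x.1)
      simp only [Complex.mul_re, Complex.mul_im]
      module
    · change (z * w).re • x.2 + (z * w).im • x.1
        = z.re • (w.re • x.2 + w.im • x.1) + z.im • (w.re • x.1 - w.im • x.2)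
      simp only [Complex.mul_re, Complex.mul_im]
      module
  smul_zero z := by
    refine Prod.ext ?_ ?_
    · change z.re • (0 : H) - z.im • (0 : H) = 0
      simp
    · change z.re • (0 : H) + z.im • (0 : H) = 0
      simp
  smul_add z x y := by
    refine Prod.ext ?_ ?_
    · change z.re • (x.1 + y.1) - z.im • (x.2 + y.2)
        = (z.re • x.1 - z.im • x.2) + (z.re • y.1 - z.im • y.2)
      module
    · change z.re • (x.2 + y.2) + z.im • (x.1 + y.1)
        = (z.re • x.2 + z.im • x.1) + (z.re • y.2 + z.im • y.1)
      module
  add_smul z w x := by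
    refine Prod.ext ?_ ?_
    · change (z + w).re • x.1 - (z + w).im • x.2
        = (z.re • x.1 - z.im • x.2) + (w.re • x.1 - w.im • x.2)
      simp only [Complex.add_re, Complex.add_im]
      module
    · change (z + w).re • x.2 + (z + w).im • x.1
        = (z.re • x.2 + z.im • x.1) + (w.re • x.2 + w.im • x.1)
      simp only [Complex.add_re, Complex.add_im]
      module
  zero_smul x := by
    refine Prod.ext ?_ ?_
    · change (0 : ℂ).re • x.1 - (0 : ℂ).im • x.2 = 0
      simp
    · change (0 : ℂ).re • x.2 + (0 : ℂ).im • x.1 = 0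
      simp

/-- The complex-linear extension of a real-linear map to the complexification. -/
def cxLift {H : Type} [AddCommGroup H] [Module ℝ H] {E : Type} [NormedAddCommGroup E]
    [InnerProductSpace ℂ E] (κ : H →ₗ[ℝ] E) : CxPair H →ₗ[ℂ] E where
  toFun x := κ x.1 + Complex.I • κ x.2
  map_add' x y := by
    change κ (x.1 + y.1) + Complex.I • κ (x.2 + y.2) = _
    simp only [map_add]
    module
  map_smul' z x := by
    change κ (z.re • x.1 - z.im • x.2) + Complex.I • κ (z.re • x.2 + z.im • x.1)
      = z • (κ x.1 + Complex.I • κ x.2)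
    simp only [map_add, map_sub, map_smul, ← Complex.coe_smul]
    rw [smul_add, smul_add, smul_smul, smul_smul, smul_smul]
    conv_rhs => rw [← Complex.re_add_im z]
    rw [add_mul, mul_assoc _ Complex.I Complex.I, Complex.I_mul_I]
    module

/-- The (pre-)inner product on the complexification determined by `α + iβ`. -/
@[reducible]
def cxCore {H : Type} [AddCommGroup H] [Module ℝ H] (α β : H → H → ℝ)
    (hαlin : ∀ h : H, IsLinearMap ℝ (α h))
    (hαsymm : ∀ h k : H, α h k = α k h)
    (hαpos : ∀ h : H, 0 ≤ α h h)
    (hβlin : ∀ h : H, IsLinearMap ℝ (β h))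
    (hβskew : ∀ h k : H, β h k = -β k h)
    (hcompat : ∀ h k : H, β h k ^ 2 ≤ α h h * α k k) :
    PreInnerProductSpace.Core ℂ (CxPair H) where
  inner x y := ⟨α x.1 y.1 + α x.2 y.2 - β x.1 y.2 + β x.2 y.1,
    β x.1 y.1 + β x.2 y.2 + α x.1 y.2 - α x.2 y.1⟩
  conj_inner_symm x y := by
    apply Complex.ext
    · simp only [Complex.conj_re]
      linarith [hαsymm x.1 y.1, hαsymm x.2 y.2, hβskew x.1 y.2, hβskew x.2 y.1]
    · simp only [Complex.conj_im]
      linarith [hβskew x.1 y.1, hβskew x.2 y.2, hαsymm x.1 y.2, hαsymm x.2 y.1]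
  re_inner_nonneg x := by
    change 0 ≤ α x.1 x.1 + α x.2 x.2 - β x.1 x.2 + β x.2 x.1
    have h1 := hcompat x.1 x.2
    have h2 := hβskew x.1 x.2
    have h3 := hαpos x.1
    have h4 := hαpos x.2
    have h5 : |2 * β x.1 x.2| ≤ α x.1 x.1 + α x.2 x.2 := by
      apply abs_le_of_sq_le_sq _ (by linarith)
      nlinarith [sq_nonneg (α x.1 x.1 - α x.2 x.2)]
    linarith [le_abs_self (2 * β x.1 x.2)]
  add_left x y z := by
    have A : ∀ a b c, α (a + b) c = α a c + α b c := fun a b c => by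
      rw [hαsymm, (hαlin c).map_add, hαsymm c a, hαsymm c b]
    have B : ∀ a b c, β (a + b) c = β a c + β b c := fun a b c => by
      rw [hβskew, (hβlin c).map_add, hβskew a c, hβskew b c]; ring
    apply Complex.ext
    · change α (x.1 + y.1) z.1 + α (x.2 + y.2) z.2 - β (x.1 + y.1) z.2 + β (x.2 + y.2) z.1
        = (α x.1 z.1 + α x.2 z.2 - β x.1 z.2 + β x.2 z.1)
          + (α y.1 z.1 + α y.2 z.2 - β y.1 z.2 + β y.2 z.1)
      simp only [A, B]; ring
    · change β (x.1 + y.1) z.1 + β (x.2 + y.2) z.2 + α (x.1 + y.1) z.2 - α (x.2 + y.2) z.1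
        = (β x.1 z.1 + β x.2 z.2 + α x.1 z.2 - α x.2 z.1)
          + (β y.1 z.1 + β y.2 z.2 + α y.1 z.2 - α y.2 z.1)
      simp only [A, B]; ring
  smul_left x y r := by
    have A : ∀ (s t : ℝ) a b c, α (s • a + t • b) c = s * α a c + t * α b c :=
      fun s t a b c => by
        rw [hαsymm, (hαlin c).map_add, (hαlin c).map_smul, (hαlin c).map_smul,
          hαsymm c a, hαsymm c b]; simp
    have B : ∀ (s t : ℝ) a b c, β (s • a + t • b) c = s * β a c + t * β b c :=
      fun s t a b c => by
        rw [hβskew, (hβlin c).map_add, (hβlin c).map_smul, (hβlin c).map_smul,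
          hβskew a c, hβskew b c]; simp; ring
    have Asub : ∀ (s t : ℝ) a b c, α (s • a - t • b) c = s * α a c - t * α b c :=
      fun s t a b c => by rw [sub_eq_add_neg, ← neg_smul, A]; ring
    have Bsub : ∀ (s t : ℝ) a b c, β (s • a - t • b) c = s * β a c - t * β b c :=
      fun s t a b c => by rw [sub_eq_add_neg, ← neg_smul, B]; ring
    apply Complex.ext
    · rw [Complex.mul_re]
      simp only [Complex.conj_re, Complex.conj_im]
      change α (r.re • x.1 - r.im • x.2) y.1 + α (r.re • x.2 + r.im • x.1) y.2
        - β (r.re • x.1 - r.im • x.2) y.2 + β (r.re • x.2 + r.im • x.1) y.1 = _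
      simp only [A, B, Asub, Bsub]; ring
    · rw [Complex.mul_im]
      simp only [Complex.conj_re, Complex.conj_im]
      change β (r.re • x.1 - r.im • x.2) y.1 + β (r.re • x.2 + r.im • x.1) y.2
        + α (r.re • x.1 - r.im • x.2) y.2 - α (r.re • x.2 + r.im • x.1) y.1 = _
      simp only [A, B, Asub, Bsub]; ring

theorem norm_cxLift_sq {H : Type} [AddCommGroup H] [Module ℝ H] {α β : H → H → ℝ}
    {E : Type} [NormedAddCommGroup E] [InnerProductSpace ℂ E] [CompleteSpace E]
    {κ : H →ₗ[ℝ] E} (hκ : IsOneParticle α β κ) (x : CxPair H) :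
    ‖cxLift κ x‖ ^ 2 = α x.1 x.1 + α x.2 x.2 - β x.1 x.2 + β x.2 x.1 := by
  obtain ⟨hr, hi, -⟩ := hκ
  change ‖κ x.1 + Complex.I • κ x.2‖ ^ 2 = _
  rw [@norm_sq_eq_re_inner ℂ]
  simp only [inner_add_left, inner_add_right, inner_smul_left, inner_smul_right]
  simp [← hr, ← hi]
  ring

theorem denseRange_cxLift {H : Type} [AddCommGroup H] [Module ℝ H] {α β : H → H → ℝ}
    {E : Type} [NormedAddCommGroup E] [InnerProductSpace ℂ E] [CompleteSpace E]
    {κ : H →ₗ[ℝ] E} (hκ : IsOneParticle α β κ) : DenseRange (cxLift κ) := by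
  refine hκ.2.2.mono ?_
  rintro z ⟨a, b, rfl⟩
  exact ⟨cxMk a b, rfl⟩

theorem cxLift_ofReal {H : Type} [AddCommGroup H] [Module ℝ H]
    {E : Type} [NormedAddCommGroup E] [InnerProductSpace ℂ E]
    (κ : H →ₗ[ℝ] E) (h : H) : cxLift κ (cxMk h 0) = κ h := by
  change κ h + Complex.I • κ 0 = κ h
  simp

theorem exists_oneParticle {H : Type} [AddCommGroup H] [Module ℝ H] (α β : H → H → ℝ)
    (hαlin : ∀ h : H, IsLinearMap ℝ (α h))
    (hβlin : ∀ h : H, IsLinearMap ℝ (β h))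
    (hβskew : ∀ h k : H, β h k = -β k h)
    (c : PreInnerProductSpace.Core ℂ (CxPair H))
    (hc : ∀ x y : CxPair H, c.inner x y = ⟨α x.1 y.1 + α x.2 y.2 - β x.1 y.2 + β x.2 y.1,
      β x.1 y.1 + β x.2 y.2 + α x.1 y.2 - α x.2 y.1⟩)
    (hαsymm : ∀ h k : H, α h k = α k h) :
    ∃ (ℋ : Type) (_ : NormedAddCommGroup ℋ) (_ : InnerProductSpace ℂ ℋ)
        (_ : CompleteSpace ℋ) (κ : H →ₗ[ℝ] ℋ), IsOneParticle α β κ := by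
  let _ : SeminormedAddCommGroup (CxPair H) :=
    @InnerProductSpace.Core.toSeminormedAddCommGroup ℂ (CxPair H) _ _ _ c
  let _ : InnerProductSpace ℂ (CxPair H) := InnerProductSpace.ofCore c
  let ι : H →ₗ[ℝ] UniformSpace.Completion (CxPair H) :=
    { toFun := fun h => (cxMk h 0 : UniformSpace.Completion (CxPair H))
      map_add' := fun h k => by
        rw [← UniformSpace.Completion.coe_add]
        congr 1
        exact Prod.ext rfl (add_zero (0 : H)).symm
      map_smul' := fun r h => by
        rw [RingHom.id_apply, ← Complex.coe_smul, ← UniformSpace.Completion.coe_smul]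
        congr 1
        refine Prod.ext ?_ ?_
        · change r • h = (r : ℂ).re • h - (r : ℂ).im • (0 : H)
          simp
        · change (0 : H) = (r : ℂ).re • (0 : H) + (r : ℂ).im • h
          simp }
  have α0 : ∀ h, α h 0 = 0 := fun h => (hαlin h).map_zero
  have β0 : ∀ h, β h 0 = 0 := fun h => (hβlin h).map_zero
  have αz : ∀ h, α 0 h = 0 := fun h => by rw [hαsymm, α0]
  have βz : ∀ h, β 0 h = 0 := fun h => by rw [hβskew, β0, neg_zero]
  have key : ∀ h k, ⟪ι h, ι k⟫_ℂ = ⟨α h k, β h k⟩ := fun h k => by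
    refine (UniformSpace.Completion.inner_coe (𝕜 := ℂ) _ _).trans ((hc _ _).trans ?_)
    simp [cxMk, α0, β0, αz, βz]
  refine ⟨UniformSpace.Completion (CxPair H), inferInstance, inferInstance, inferInstance, ι,
    fun h k => by rw [key], fun h k => by rw [key], ?_⟩
  refine (UniformSpace.Completion.denseRange_coe (α := CxPair H)).mono ?_
  rintro _ ⟨x, rfl⟩
  refine ⟨x.1, x.2, ?_⟩
  change (x : UniformSpace.Completion (CxPair H)) =
    (cxMk x.1 0 : UniformSpace.Completion (CxPair H)) +
    Complex.I • (cxMk x.2 0 : UniformSpace.Completion (CxPair H))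
  rw [← UniformSpace.Completion.coe_smul, ← UniformSpace.Completion.coe_add]
  congr 1
  refine Prod.ext ?_ ?_
  · change x.1 = x.1 + (Complex.I.re • x.2 - Complex.I.im • (0 : H))
    simp
  · change x.2 = 0 + (Complex.I.re • (0 : H) + Complex.I.im • x.2)
    simp

theorem one_particle_structure_exists_and_unique
    (H : Type) [AddCommGroup H] [Module ℝ H] (α β : H → H → ℝ)
    -- α is a real scalar product
    (hαlin : ∀ h : H, IsLinearMap ℝ (α h))
    (hαsymm : ∀ h k : H, α h k = α k h)
    (hαpos : ∀ h : H, 0 ≤ α h h)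
    (hαdef : ∀ h : H, α h h = 0 → h = 0)
    -- β is a symplectic (bilinear antisymmetric) form
    (hβlin : ∀ h : H, IsLinearMap ℝ (β h))
    (hβskew : ∀ h k : H, β h k = -β k h)
    -- compatibility
    (hcompat : ∀ h k : H, β h k ^ 2 ≤ α h h * α k k) :
    -- existence
    (∃ (ℋ : Type) (_ : NormedAddCommGroup ℋ) (_ : InnerProductSpace ℂ ℋ)
        (_ : CompleteSpace ℋ) (κ : H →ₗ[ℝ] ℋ), IsOneParticle α β κ) ∧
    -- uniqueness: any two one-particle structures are intertwined by a unitary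
    (∀ (ℋ ℋ' : Type) (_ : NormedAddCommGroup ℋ) (_ : InnerProductSpace ℂ ℋ)
        (_ : CompleteSpace ℋ) (_ : NormedAddCommGroup ℋ') (_ : InnerProductSpace ℂ ℋ')
        (_ : CompleteSpace ℋ') (κ : H →ₗ[ℝ] ℋ) (κ' : H →ₗ[ℝ] ℋ'),
        IsOneParticle α β κ → IsOneParticle α β κ' →
        ∃ U : ℋ ≃ₗᵢ[ℂ] ℋ', ∀ h : H, U (κ h) = κ' h) := by
  refine ⟨exists_oneParticle α β hαlin hβlin hβskew
    (cxCore α β hαlin hαsymm hαpos hβlin hβskew hcompat) (fun _ _ => rfl) hαsymm, ?_⟩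
  intro E E' _ _ _ _ _ _ κ κ' hκ hκ'
  have hn : ∀ x, ‖cxLift κ' ((LinearEquiv.refl ℂ (CxPair H)) x)‖ = ‖cxLift κ x‖ := fun x => by
    rw [← sq_eq_sq₀ (norm_nonneg _) (norm_nonneg _), LinearEquiv.refl_apply,
      norm_cxLift_sq hκ, norm_cxLift_sq hκ']
  refine ⟨(LinearEquiv.refl ℂ (CxPair H)).extendOfIsometry (cxLift κ) (cxLift κ')
    (denseRange_cxLift hκ) (denseRange_cxLift hκ') hn, fun h => ?_⟩
  rw [← cxLift_ofReal κ h, LinearEquiv.extendOfIsometry_eq, LinearEquiv.refl_apply,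
    cxLift_ofReal]
end
end

section
/- Let H be a closed real-linear subspace of a complex Hilbert space ℋ, with polariser D_H. Then ker(D_H² + 1) = H ∩ iH, so H is separating if and only if ker(D_H² + 1) = {0}. Moreover ker(D_H) = {h ∈ H : Im(h,k) = 0 for all k ∈ H} = H ∩ H', so H is factorial if and only if ker(D_H) = {0}. -/
/-!
Statement 1: For a closed real-linear subspace `H` of a complex Hilbert space `ℋ` with
polariser `D_H` (the bounded real-linear operator on `H` with
`Im ⟪h,k⟫ = Re ⟪h, D_H k⟫`), one has `ker (D_H² + 1) = H ∩ iH` (so `H` is separating iff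
`ker (D_H² + 1) = {0}`) and `ker D_H = {h ∈ H : Im ⟪h,k⟫ = 0 ∀ k ∈ H} = H ∩ H'`
(so `H` is factorial iff `ker D_H = {0}`).
-/

open scoped InnerProductSpace

attribute [local instance] InnerProductSpace.complexToReal

noncomputable section

/-- Multiplication by `Complex.I`, as a real-linear map. -/
def mulI (ℋ : Type) [NormedAddCommGroup ℋ] [InnerProductSpace ℂ ℋ] : ℋ →ₗ[ℝ] ℋ :=
  (Complex.I • (LinearMap.id : ℋ →ₗ[ℂ] ℋ)).restrictScalars ℝ

/-- The symplectic complement `H' = (iH)^⊥`, the orthogonal complement of `iH` with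
respect to the real part of the inner product. -/
def sympComp {ℋ : Type} [NormedAddCommGroup ℋ] [InnerProductSpace ℂ ℋ]
    (H : Submodule ℝ ℋ) : Submodule ℝ ℋ :=
  (H.map (mulI ℋ))ᗮ

theorem mem_map_mulI_iff {ℋ : Type} [NormedAddCommGroup ℋ] [InnerProductSpace ℂ ℋ]
    (H : Submodule ℝ ℋ) (x : ℋ) : x ∈ H.map (mulI ℋ) ↔ ∃ k ∈ H, Complex.I • k = x := Iff.rfl

theorem eq_of_re {ℋ : Type} [NormedAddCommGroup ℋ] [InnerProductSpace ℂ ℋ]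
    (H : Submodule ℝ ℋ) (x y : ↥H)
    (h : ∀ k : ↥H, (⟪(k : ℋ), (x : ℋ)⟫_ℂ).re = (⟪(k : ℋ), (y : ℋ)⟫_ℂ).re) : x = y := by
  have h1 := h (x - y)
  have h2 : (⟪((x - y : ↥H) : ℋ), ((x - y : ↥H) : ℋ)⟫_ℂ).re = 0 := by
    conv_lhs => rw [Submodule.coe_sub, inner_sub_right, ← Submodule.coe_sub]
    rw [Complex.sub_re, h1, sub_self]
  have h3 : ((x - y : ↥H) : ℋ) = 0 := by
    have := inner_self_eq_norm_sq (𝕜 := ℂ) ((x - y : ↥H) : ℋ)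
    rw [← norm_eq_zero, ← sq_eq_zero_iff, ← this]
    exact h2
  exact sub_eq_zero.mp (Subtype.ext h3)

theorem inf_bot_iff {ℋ : Type} [NormedAddCommGroup ℋ] [InnerProductSpace ℂ ℋ]
    (H K : Submodule ℝ ℋ) (P : ↥H → Prop) (hP : ∀ h : ↥H, P h ↔ (h : ℋ) ∈ K) :
    H ⊓ K = ⊥ ↔ ∀ h : ↥H, P h → h = 0 := by
  rw [Submodule.eq_bot_iff]
  constructor
  · intro a h hh
    exact Subtype.ext (a h ⟨h.2, (hP h).1 hh⟩)
  · rintro a x ⟨hx, hk⟩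
    exact congrArg Subtype.val (a ⟨x, hx⟩ ((hP ⟨x, hx⟩).2 hk))

theorem polariser_kernels
    {ℋ : Type} [NormedAddCommGroup ℋ] [InnerProductSpace ℂ ℋ] [CompleteSpace ℋ]
    (H : Submodule ℝ ℋ) (hH : IsClosed (H : Set ℋ))
    (D : ↥H →L[ℝ] ↥H)
    (hD : ∀ h k : ↥H, (⟪(h : ℋ), (k : ℋ)⟫_ℂ).im = ⟪(h : ℋ), ((D k : ↥H) : ℋ)⟫_ℝ) :
    -- ker (D_H² + 1) = H ∩ iH
    (∀ h : ↥H, D (D h) + h = 0 ↔ (h : ℋ) ∈ H.map (mulI ℋ)) ∧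
    -- H separating iff ker (D_H² + 1) = {0}
    ((H ⊓ H.map (mulI ℋ) = ⊥) ↔ ∀ h : ↥H, D (D h) + h = 0 → h = 0) ∧
    -- ker D_H = {h ∈ H : β(h,k) = 0 for all k ∈ H}
    (∀ h : ↥H, D h = 0 ↔ ∀ k : ↥H, (⟪(h : ℋ), (k : ℋ)⟫_ℂ).im = 0) ∧
    -- ker D_H = H ∩ H'
    (∀ h : ↥H, D h = 0 ↔ (h : ℋ) ∈ sympComp H) ∧
    -- H factorial iff ker D_H = {0}
    ((H ⊓ sympComp H = ⊥) ↔ ∀ h : ↥H, D h = 0 → h = 0) := by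
  have A : ∀ k h : ↥H, (⟪(k : ℋ), ((D h : ↥H) : ℋ)⟫_ℂ).re = (⟪(k : ℋ), (h : ℋ)⟫_ℂ).im :=
    fun k h => (hD k h).symm
  have S : ∀ x y : ℋ, (⟪x, y⟫_ℂ).im = - (⟪y, x⟫_ℂ).im := fun x y => by
    rw [← inner_conj_symm, Complex.conj_im]
  have R : ∀ x y : ℋ, (⟪x, y⟫_ℂ).re = (⟪y, x⟫_ℂ).re := fun x y => by
    rw [← inner_conj_symm, Complex.conj_re]
  have c1 : ∀ h : ↥H, D (D h) + h = 0 ↔ (h : ℋ) ∈ H.map (mulI ℋ) := by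
    intro h
    rw [mem_map_mulI_iff]
    constructor
    · intro e
      refine ⟨(D h : ↥H), (D h).2, ?_⟩
      have e1 : D (D h) = -h := eq_neg_of_add_eq_zero_left e
      have a1 := A h (D h)
      rw [e1, Submodule.coe_neg, inner_neg_right, Complex.neg_re] at a1
      have a2 := A (D h) h
      have a3 := S (h : ℋ) (D h : ↥H)
      rw [← sub_eq_zero, ← inner_self_eq_zero (𝕜 := ℂ)]
      have a4 := inner_self_im (𝕜 := ℂ) (Complex.I • ((D h : ↥H) : ℋ) - (h : ℋ))
      apply Complex.ext _ a4
      simp only [inner_sub_left, inner_sub_right, inner_smul_left, inner_smul_right]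
      simp [-inner_self_eq_norm_sq_to_K]
      linarith
    · rintro ⟨k, hk, e⟩
      have d1 : D h = ⟨k, hk⟩ := by
        apply eq_of_re
        intro l
        rw [A, ← e, inner_smul_right]
        simp
      have d2 : D ⟨k, hk⟩ = -h := by
        apply eq_of_re
        intro l
        rw [A, Submodule.coe_neg, ← e, inner_neg_right, inner_smul_right]
        simp
      rw [d1, d2, neg_add_cancel]
  have c3 : ∀ h : ↥H, D h = 0 ↔ ∀ k : ↥H, (⟪(h : ℋ), (k : ℋ)⟫_ℂ).im = 0 := by
    intro h
    constructor
    · intro e k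
      rw [S, ← A, e]
      simp
    · intro e
      apply eq_of_re
      intro k
      rw [A, S, e]
      simp
  have c4 : ∀ h : ↥H, D h = 0 ↔ (h : ℋ) ∈ sympComp H := by
    intro h
    rw [c3, sympComp, Submodule.mem_orthogonal]
    have T : ∀ k : ℋ, ⟪Complex.I • k, (h : ℋ)⟫_ℝ = - (⟪(h : ℋ), k⟫_ℂ).im := by
      intro k
      change (⟪Complex.I • k, (h : ℋ)⟫_ℂ).re = _
      rw [inner_smul_left, S]
      simp
    constructor
    · rintro e _ ⟨k, hk, rfl⟩
      refine (T k).trans ?_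
      rw [e ⟨k, hk⟩, neg_zero]
    · intro e k
      have := (T k).symm.trans (e _ ⟨k, k.2, rfl⟩)
      linarith
  exact ⟨c1, inf_bot_iff H _ _ c1, c3, c4, inf_bot_iff H _ _ c4⟩
end
end

section
/- Let H be a closed real-linear subspace of a complex Hilbert space ℋ with polariser D_H, and let h ∈ H. The following are equivalent: (i) (D_H² + 1)h = 0; (ii) ‖D_H h‖ = ‖h‖; (iii) D_H h = −ih. -/
/-!
Statement 2: For a closed real-linear subspace `H` of a complex Hilbert space with
polariser `D_H` and `h ∈ H`, the following are equivalent: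
(i) `(D_H² + 1) h = 0`; (ii) `‖D_H h‖ = ‖h‖`; (iii) `D_H h = -i h`.
-/

open scoped InnerProductSpace

attribute [local instance] InnerProductSpace.complexToReal

noncomputable section

theorem polariser_norm_one_iff
    {ℋ : Type} [NormedAddCommGroup ℋ] [InnerProductSpace ℂ ℋ] [CompleteSpace ℋ]
    (H : Submodule ℝ ℋ) (hH : IsClosed (H : Set ℋ))
    (D : ↥H →L[ℝ] ↥H)
    (hD : ∀ h k : ↥H, (⟪(h : ℋ), (k : ℋ)⟫_ℂ).im = ⟪(h : ℋ), ((D k : ↥H) : ℋ)⟫_ℝ)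
    (h : ↥H) :
    (D (D h) + h = 0 ↔ ‖D h‖ = ‖h‖) ∧
    (‖D h‖ = ‖h‖ ↔ ((D h : ↥H) : ℋ) = -(Complex.I • (h : ℋ))) := by
  have key : ∀ x k : ↥H, ⟪(x : ℋ), ((D k : ↥H) : ℋ)⟫_ℝ
      = -⟪(x : ℋ), Complex.I • (k : ℋ)⟫_ℝ := by
    intro x k
    rw [← hD x k, real_inner_eq_re_inner ℂ, inner_smul_right]
    simp
  have skew : ⟪(h : ℋ), ((D (D h) : ↥H) : ℋ)⟫_ℝ = -‖((D h : ↥H) : ℋ)‖ ^ 2 := by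
    rw [← hD h (D h), ← real_inner_self_eq_norm_sq, ← hD (D h) h,
      ← inner_conj_symm (h : ℋ) ((D h : ↥H) : ℋ), Complex.conj_im]
  have nI : ‖Complex.I • (h : ℋ)‖ = ‖(h : ℋ)‖ := by
    rw [norm_smul, Complex.norm_I, one_mul]
  have h12 : D (D h) + h = 0 → ‖D h‖ = ‖h‖ := by
    intro e
    rw [eq_neg_of_add_eq_zero_left e, Submodule.coe_neg, inner_neg_right,
      real_inner_self_eq_norm_sq, neg_inj] at skew
    exact ((sq_eq_sq₀ (norm_nonneg _) (norm_nonneg _)).1 skew).symm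
  have h23 : ‖D h‖ = ‖h‖ → ((D h : ↥H) : ℋ) = -(Complex.I • (h : ℋ)) := by
    intro e
    have e' : ‖((D h : ↥H) : ℋ)‖ = ‖(h : ℋ)‖ := e
    have k1 := key (D h) h
    rw [real_inner_self_eq_norm_sq] at k1
    have k2 := norm_add_sq_real ((D h : ↥H) : ℋ) (Complex.I • (h : ℋ))
    rw [nI, ← e'] at k2
    have k3 : ‖((D h : ↥H) : ℋ) + Complex.I • (h : ℋ)‖ ^ 2 = 0 := by linarith
    exact eq_neg_of_add_eq_zero_left (norm_eq_zero.1 (pow_eq_zero_iff two_ne_zero |>.1 k3))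
  have h31 : ((D h : ↥H) : ℋ) = -(Complex.I • (h : ℋ)) → D (D h) + h = 0 := by
    intro e
    have k1 := key (D (D h) + h) (D h)
    have e2 : Complex.I • ((D h : ↥H) : ℋ) = (h : ℋ) := by
      rw [e, smul_neg, smul_smul, Complex.I_mul_I, neg_smul, one_smul, neg_neg]
    rw [e2] at k1
    have k2 : ⟪((D (D h) + h : ↥H) : ℋ), ((D (D h) + h : ↥H) : ℋ)⟫_ℝ = 0 := by
      conv_lhs => rw [Submodule.coe_add, inner_add_right]
      rw [Submodule.coe_add] at k1
      linarith
    exact Subtype.ext (inner_self_eq_zero.1 k2)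
  exact ⟨⟨h12, fun e => h31 (h23 e)⟩, ⟨h23, fun e => h12 (h31 e)⟩⟩
end
end

section
/- Let H ⊆ ℋ be a factorial standard subspace with polariser D_H. Then √(1 + D_H²) = 2(Δ_H^{1/2} + Δ_H^{-1/2})^{-1}|_H = (cosh(L_H/2))^{-1}|_H, and D_H^{-1}·√(1 + D_H²) = −2i(Δ_H^{1/2} − Δ_H^{-1/2})^{-1}|_H = −i·(sinh(L_H/2))^{-1}|_H, where √(1 + D_H²) is the positive square root of the bounded positive operator 1 + D_H² on the real Hilbert space (H, Re(·,·)). -/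
/-!
Statement 4: for a factorial standard subspace `H ⊆ ℋ` with polariser `D_H`,
`√(1 + D_H²) = 2 (Δ_H^{1/2} + Δ_H^{-1/2})⁻¹|_H = (cosh(L_H/2))⁻¹|_H` and
`D_H⁻¹ √(1 + D_H²) = -2i (Δ_H^{1/2} - Δ_H^{-1/2})⁻¹|_H = -i (sinh(L_H/2))⁻¹|_H`.
In terms of `R = (1 + Δ_H)⁻¹` and `W = Δ_H^{1/2}(1 + Δ_H)⁻¹`:
`2(Δ^{1/2} + Δ^{-1/2})⁻¹ = cosh(L/2)⁻¹ = 2W` and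
`-2i(Δ^{1/2} - Δ^{-1/2})⁻¹ = -i sinh(L/2)⁻¹ = -2i W (1 - 2R)⁻¹`.
`Q` below is the positive square root of `1 + D_H²` on `(H, Re ⟪·,·⟫)`.
-/
open scoped InnerProductSpace

attribute [local instance] InnerProductSpace.complexToReal

noncomputable section

/-- Encoding of the modular data `(Δ_H, J_H)` of a standard subspace `H`:
`R = (1 + Δ_H)⁻¹` (a positive injective contraction with `1 - R` injective),
`W = Δ_H^{1/2} (1 + Δ_H)⁻¹` (the positive square root of `R - R²`), and the modular
conjugation `J = J_H` (a conjugate-linear isometric involution with `J Δ J = Δ⁻¹`,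
i.e. `J R J = 1 - R`, and `J W = W J`).  The subspace `H` is recovered through the
formula `E_H = (1 + Δ_H)⁻¹ + J_H Δ_H^{1/2} (1 + Δ_H)⁻¹`, i.e. `x ∈ H ↔ R x + J W x = x`;
moreover `J_H H = H'`. -/
structure ModularData (ℋ : Type) [NormedAddCommGroup ℋ] [InnerProductSpace ℂ ℋ]
    (H : Submodule ℝ ℋ) : Type where
  R : ℋ →L[ℂ] ℋ
  W : ℋ →L[ℂ] ℋ
  J : ℋ →ₗ[ℝ] ℋ
  R_sa : ∀ x y : ℋ, ⟪R x, y⟫_ℂ = ⟪x, R y⟫_ℂ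
  R_pos : ∀ x : ℋ, 0 ≤ (⟪x, R x⟫_ℂ).re
  R_le_one : ∀ x : ℋ, (⟪x, R x⟫_ℂ).re ≤ ‖x‖ ^ 2
  R_inj : ∀ x : ℋ, R x = 0 → x = 0
  oneSubR_inj : ∀ x : ℋ, R x = x → x = 0
  W_sa : ∀ x y : ℋ, ⟪W x, y⟫_ℂ = ⟪x, W y⟫_ℂ
  W_pos : ∀ x : ℋ, 0 ≤ (⟪x, W x⟫_ℂ).re
  W_sq : ∀ x : ℋ, W (W x) = R x - R (R x)
  WR_comm : ∀ x : ℋ, W (R x) = R (W x)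
  J_conjI : ∀ x : ℋ, J (Complex.I • x) = -(Complex.I • J x)
  J_isom : ∀ x : ℋ, ‖J x‖ = ‖x‖
  J_invol : ∀ x : ℋ, J (J x) = x
  J_R : ∀ x : ℋ, J (R x) = J x - R (J x)
  J_W : ∀ x : ℋ, J (W x) = W (J x)
  memH_iff : ∀ x : ℋ, x ∈ H ↔ R x + J (W x) = x
  J_mapsH : ∀ x ∈ H, J x ∈ sympComp H
  J_mapsH' : ∀ x ∈ sympComp H, J x ∈ H

/-- Two positive symmetric operators with the same square coincide. -/
theorem pos_sqrt_unique {E : Type} [NormedAddCommGroup E] [InnerProductSpace ℝ E]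
    (A B : E →L[ℝ] E)
    (hA : ∀ x y, ⟪A x, y⟫_ℝ = ⟪x, A y⟫_ℝ) (hB : ∀ x y, ⟪B x, y⟫_ℝ = ⟪x, B y⟫_ℝ)
    (hAp : ∀ x, 0 ≤ ⟪x, A x⟫_ℝ) (hBp : ∀ x, 0 ≤ ⟪x, B x⟫_ℝ)
    (hsq : ∀ x, A (A x) = B (B x)) : A = B := by
  have hXsym : (A - B).IsSymmetric := by
    intro x y
    have h1 := hA x y
    have h2 := hB x y
    simp only [ContinuousLinearMap.coe_coe, ContinuousLinearMap.sub_apply, inner_sub_left, inner_sub_right]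
    linarith
  set M := ‖A - B‖ with hM
  set K := ‖A + B‖ with hK
  have hM0 : 0 ≤ M := norm_nonneg _
  have hK0 : 0 ≤ K := norm_nonneg _
  have key : ∀ v : E, v ≠ 0 → ((A - B).rayleighQuotient v) ^ 4
      + K ^ 2 * ((A - B).rayleighQuotient v) ^ 2 ≤ K ^ 2 * M ^ 2 := by
    intro v hv
    have hn : 0 < ‖v‖ := norm_pos_iff.mpr hv
    set l := (A - B).rayleighQuotient v with hl
    have hl' : ⟪(A - B) v, v⟫_ℝ = l * ‖v‖ ^ 2 := by
      rw [hl, ContinuousLinearMap.rayleighQuotient, ContinuousLinearMap.reApplyInnerSelf_apply]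
      simp only [RCLike.re_to_real]
      field_simp
    have horth : ⟪(A + B) v, (A - B) v⟫_ℝ = 0 := by
      have e1 : ⟪A v, A v⟫_ℝ = ⟪B v, B v⟫_ℝ := by rw [hA, hB, hsq]
      have e2 := real_inner_comm (A v) (B v)
      simp only [ContinuousLinearMap.sub_apply, ContinuousLinearMap.add_apply,
        inner_sub_right, inner_add_left]
      linarith
    have hYnn : |l| * ‖v‖ ^ 2 ≤ ⟪(A + B) v, v⟫_ℝ := by
      have a1 := hAp v
      have a2 := hBp v
      rw [← hA] at a1
      rw [← hB] at a2
      have : |l| * ‖v‖ ^ 2 = |l * ‖v‖ ^ 2| := by rw [abs_mul, abs_of_nonneg (sq_nonneg ‖v‖)]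
      rw [this, ← hl', abs_le]
      simp only [ContinuousLinearMap.sub_apply, ContinuousLinearMap.add_apply,
        inner_sub_left, inner_add_left]
      constructor <;> linarith
    set r := (A - B) v - l • v with hr
    have hXn : ‖(A - B) v‖ ^ 2 ≤ M ^ 2 * ‖v‖ ^ 2 := by
      rw [← mul_pow]
      exact pow_le_pow_left₀ (norm_nonneg _) ((A - B).le_opNorm v) 2
    have hrn : ‖r‖ ^ 2 ≤ (M ^ 2 - l ^ 2) * ‖v‖ ^ 2 := by
      rw [hr, norm_sub_sq_real, inner_smul_right, hl', norm_smul, mul_pow, Real.norm_eq_abs, sq_abs]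
      nlinarith
    have hYr : ⟪(A + B) v, r⟫_ℝ = - (l * ⟪(A + B) v, v⟫_ℝ) := by
      rw [hr, inner_sub_right, horth, inner_smul_right]; ring
    have h1 : |l| * ⟪(A + B) v, v⟫_ℝ ≤ K * ‖v‖ * ‖r‖ := by
      have := abs_real_inner_le_norm ((A + B) v) r
      rw [hYr, abs_neg, abs_mul] at this
      have h2 := (A + B).le_opNorm v
      have h3 := le_abs_self ⟪(A + B) v, v⟫_ℝ
      calc |l| * ⟪(A + B) v, v⟫_ℝ ≤ |l| * |⟪(A + B) v, v⟫_ℝ| := by gcongr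
        _ ≤ ‖(A + B) v‖ * ‖r‖ := this
        _ ≤ _ := by gcongr
    have h2 : l ^ 2 * ‖v‖ ^ 2 ≤ K * ‖v‖ * ‖r‖ := by
      calc l ^ 2 * ‖v‖ ^ 2 = |l| * (|l| * ‖v‖ ^ 2) := by rw [← sq_abs]; ring
        _ ≤ |l| * ⟪(A + B) v, v⟫_ℝ := by gcongr
        _ ≤ _ := h1
    have h3 : (l ^ 2 * ‖v‖ ^ 2) ^ 2 ≤ (K * ‖v‖ * ‖r‖) ^ 2 :=
      pow_le_pow_left₀ (by positivity) h2 2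
    have h4 : (K * ‖v‖ * ‖r‖) ^ 2 ≤ K ^ 2 * ‖v‖ ^ 2 * ((M ^ 2 - l ^ 2) * ‖v‖ ^ 2) := by
      rw [mul_pow, mul_pow]
      gcongr
    have h5 : (l ^ 4) * ‖v‖ ^ 4 ≤ (K ^ 2 * (M ^ 2 - l ^ 2)) * ‖v‖ ^ 4 := by nlinarith
    have h6 := le_of_mul_le_mul_right h5 (by positivity)
    linarith
  have hMz : M = 0 := by
    by_contra hne
    have hMpos : 0 < M := lt_of_le_of_ne hM0 (Ne.symm hne)
    have hb : ∀ b ∈ Set.Ioo 0 M, b ^ 4 + K ^ 2 * b ^ 2 ≤ K ^ 2 * M ^ 2 := by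
      rintro b ⟨hb0, hbM⟩
      rw [hM, ContinuousLinearMap.norm_eq_iSup_rayleighQuotient _ hXsym] at hbM
      obtain ⟨v, hv⟩ := exists_lt_of_lt_ciSup hbM
      have hv0 : v ≠ 0 := by
        rintro rfl
        simp at hv
        linarith
      have := key v hv0
      have e4 : |(A - B).rayleighQuotient v| ^ 4 = (A - B).rayleighQuotient v ^ 4 :=
        Even.pow_abs (by decide) _
      rw [← e4, ← sq_abs ((A - B).rayleighQuotient v)] at this
      refine le_trans ?_ this
      gcongr
    have hcl : M ∈ closure (Set.Ioo 0 M) := by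
      rw [closure_Ioo hMpos.ne]
      exact ⟨hM0, le_rfl⟩
    have hcl2 : IsClosed {b : ℝ | b ^ 4 + K ^ 2 * b ^ 2 ≤ K ^ 2 * M ^ 2} :=
      isClosed_le (by fun_prop) (by fun_prop)
    have hsub : Set.Ioo 0 M ⊆ {b : ℝ | b ^ 4 + K ^ 2 * b ^ 2 ≤ K ^ 2 * M ^ 2} := by
      intro b hb'
      rw [Set.mem_setOf_eq]
      exact hb b hb'
    have hfin := closure_minimal hsub hcl2 hcl
    rw [Set.mem_setOf_eq] at hfin
    have : 0 < M ^ 4 := by positivity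
    linarith
  exact sub_eq_zero.mp (norm_eq_zero.mp hMz)

theorem sqrt_one_add_polariser_sq_eq_inv_cosh
    {ℋ : Type} [NormedAddCommGroup ℋ] [InnerProductSpace ℂ ℋ] [CompleteSpace ℋ]
    (H : Submodule ℝ ℋ) (hH : IsClosed (H : Set ℋ))
    (hcyc : Dense ((H ⊔ H.map (mulI ℋ) : Submodule ℝ ℋ) : Set ℋ))
    (hsep : H ⊓ H.map (mulI ℋ) = ⊥)
    (hfac : H ⊓ sympComp H = ⊥)
    (md : ModularData ℋ H)
    (D Q : ↥H →L[ℝ] ↥H)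
    (hD : ∀ h k : ↥H, (⟪(h : ℋ), (k : ℋ)⟫_ℂ).im = ⟪(h : ℋ), ((D k : ↥H) : ℋ)⟫_ℝ)
    -- Q is the positive square root of 1 + D²
    (hQsym : ∀ h k : ↥H, ⟪((Q h : ↥H) : ℋ), (k : ℋ)⟫_ℝ = ⟪(h : ℋ), ((Q k : ↥H) : ℋ)⟫_ℝ)
    (hQpos : ∀ h : ↥H, 0 ≤ ⟪(h : ℋ), ((Q h : ↥H) : ℋ)⟫_ℝ)
    (hQsq : ∀ h : ↥H, Q (Q h) = h + D (D h)) :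
    -- √(1 + D²) = 2(Δ^{1/2} + Δ^{-1/2})⁻¹|_H = cosh(L_H/2)⁻¹|_H = 2 W|_H
    (∀ h : ↥H, ((Q h : ↥H) : ℋ) = (2 : ℝ) • md.W (h : ℋ)) ∧
    -- D⁻¹√(1 + D²) = -2i(Δ^{1/2} - Δ^{-1/2})⁻¹|_H = -i sinh(L_H/2)⁻¹|_H = -2i W(1-2R)⁻¹|_H
    (∀ (h k : ↥H) (y : ℋ), D k = Q h → y - (2 : ℝ) • md.R y = (h : ℋ) →
        (k : ℋ) = -((2 : ℝ) • (Complex.I • md.W y))) := by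
  have two : ∀ x : ℋ, (2 : ℝ) • x = x + x := fun x => two_smul ℝ x
  have hre : ∀ x y : ℋ, ⟪x, y⟫_ℝ = (⟪x, y⟫_ℂ).re := fun x y => rfl
  have hWH : ∀ x ∈ H, md.W x ∈ H := by
    intro x hx
    rw [md.memH_iff] at hx ⊢
    rw [← md.WR_comm, md.J_W, ← map_add, hx]
  have hvH : ∀ x ∈ H, Complex.I • (x - (md.R x + md.R x)) ∈ H := by
    intro x hx
    rw [md.memH_iff] at hx ⊢
    have hJ : md.J (md.W x) = x - md.R x := eq_sub_of_add_eq' hx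
    simp only [map_smul, map_sub, map_add, md.J_conjI, md.WR_comm, md.J_R, hJ]
    module
  have hDf : ∀ k : H, ((D k : H) : ℋ) = Complex.I • ((k : ℋ) - (md.R k + md.R k)) := by
    intro k
    have hk := (md.memH_iff k).1 k.2
    have hJ : md.J (md.W k) = k - md.R k := eq_sub_of_add_eq' hk
    have : D k = ⟨_, hvH k k.2⟩ := by
      refine ext_inner_left ℝ fun h => ?_
      change ⟪(h : ℋ), ((D k : H) : ℋ)⟫_ℝ = ⟪(h : ℋ), Complex.I • ((k : ℋ) - (md.R k + md.R k))⟫_ℝ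
      rw [← hD, hre]
      have hz := md.J_mapsH k k.2
      have hz2 := (Submodule.mem_orthogonal _ _).1 hz (mulI ℋ (md.W h))
        (Submodule.mem_map_of_mem (hWH h h.2))
      have hI : mulI ℋ (md.W h) = Complex.I • md.W h := rfl
      rw [hI, hre, inner_smul_left, md.W_sa, ← md.J_W, hJ] at hz2
      simp [inner_smul_right, inner_sub_right, inner_add_right] at hz2 ⊢
      linarith
    rw [this]
  have hQ : ∀ h : ↥H, ((Q h : ↥H) : ℋ) = (2 : ℝ) • md.W (h : ℋ) := by
    let B : H →L[ℝ] H := (2 : ℝ) •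
      (((md.W.restrictScalars ℝ).comp H.subtypeL).codRestrict H fun x => hWH x x.2)
    have hB : ∀ h : H, ((B h : H) : ℋ) = md.W h + md.W h := fun h => two _
    have hQB : Q = B := by
      refine pos_sqrt_unique Q B (fun x y => hQsym x y) ?_ (fun x => hQpos x) ?_ ?_
      · intro x y
        change ⟪((B x : H) : ℋ), (y : ℋ)⟫_ℝ = ⟪(x : ℋ), ((B y : H) : ℋ)⟫_ℝ
        rw [hB, hB, hre, hre]
        simp [inner_add_left, inner_add_right, md.W_sa]
      · intro x
        change 0 ≤ ⟪(x : ℋ), ((B x : H) : ℋ)⟫_ℝ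
        rw [hB, hre, inner_add_right, Complex.add_re]
        have := md.W_pos x
        linarith
      · intro x
        rw [hQsq]
        apply Subtype.ext
        rw [hB, hB, Submodule.coe_add, hDf, hDf]
        simp only [map_smul, map_sub, map_add, md.W_sq, smul_sub, smul_add, smul_smul,
          Complex.I_mul_I]
        module
    intro h
    rw [hQB, hB, two]
  have hinj : ∀ x : ℋ, x = md.R x + md.R x → x = 0 := by
    have hstep : ∀ x : ℋ, x = md.R x + md.R x → x + md.J x = 0 := by
      intro x hx
      have hW : x = md.W x + md.W x := by
        have hW2 : md.W (md.W x) + md.W (md.W x) + md.W (md.W x) + md.W (md.W x) = x := by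
          have hx2 : md.R x = md.R (md.R x) + md.R (md.R x) := by
            conv_lhs => rw [hx, map_add]
          rw [md.W_sq]
          have h3 : md.R x - md.R (md.R x) = md.R (md.R x) := by
            rw [sub_eq_iff_eq_add]; exact hx2
          rw [h3]
          conv_rhs => rw [hx, hx2]
          abel
        have hu : md.W (md.W x + md.W x - x) + md.W (md.W x + md.W x - x)
            = -(md.W x + md.W x - x) := by
          simp only [map_sub, map_add]
          rw [neg_sub]
          calc _ = (md.W (md.W x) + md.W (md.W x) + md.W (md.W x) + md.W (md.W x))
                - (md.W x + md.W x) := by abel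
            _ = _ := by rw [hW2]
        have hp := md.W_pos (md.W x + md.W x - x)
        have hq : (⟪md.W x + md.W x - x, md.W (md.W x + md.W x - x)
            + md.W (md.W x + md.W x - x)⟫_ℂ).re = - ‖md.W x + md.W x - x‖ ^ 2 := by
          rw [hu, inner_neg_right, Complex.neg_re, inner_self_eq_norm_sq_to_K]
          norm_cast
        rw [inner_add_right, Complex.add_re] at hq
        have : ‖md.W x + md.W x - x‖ ^ 2 = 0 := by
          have := sq_nonneg ‖md.W x + md.W x - x‖
          linarith
        have := norm_eq_zero.mp (pow_eq_zero_iff (two_ne_zero) |>.mp this)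
        exact (sub_eq_zero.mp this).symm
      have hmem : x + md.J x ∈ H := by
        rw [md.memH_iff]
        have e1 : md.R (md.J x) = md.J x - md.J (md.R x) := by rw [md.J_R]; abel
        have e2 : md.J x = md.J (md.R x) + md.J (md.R x) := by
          conv_lhs => rw [hx, map_add]
        have e3 : md.J x = md.J (md.W x) + md.J (md.W x) := by
          conv_lhs => rw [hW, map_add]
        have e4 : md.J (md.W (md.J x)) = md.W x := by rw [← md.J_W, md.J_invol]
        have e5 : md.J (md.R x) = md.J (md.W x) := by
          have : (2 : ℝ) • md.J (md.R x) = (2 : ℝ) • md.J (md.W x) := by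
            rw [two, two, ← e2, ← e3]
          exact smul_right_injective ℋ (two_ne_zero) this
        have e6 : md.R x = md.W x := by
          have := congrArg md.J e5
          rwa [md.J_invol, md.J_invol] at this
        rw [map_add, map_add, map_add, e1, e4, e5, e6]
        calc _ = (md.W x + md.W x) + md.J x := by abel
          _ = _ := by rw [← hW]
      have hJ : md.J (x + md.J x) = x + md.J x := by
        rw [map_add, md.J_invol, add_comm]
      have hm2 : x + md.J x ∈ sympComp H := by
        have := md.J_mapsH _ hmem
        rwa [hJ] at this
      have : x + md.J x ∈ H ⊓ sympComp H := ⟨hmem, hm2⟩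
      rw [hfac] at this
      exact (Submodule.mem_bot ℝ).1 this
    intro x hx
    have h1 := hstep x hx
    have h2 := hstep (Complex.I • x) (by rw [map_smul, ← smul_add, ← hx])
    rw [md.J_conjI, ← sub_eq_add_neg, ← smul_sub] at h2
    have h3 := (smul_eq_zero.mp h2).resolve_left Complex.I_ne_zero
    have h4 : (2 : ℝ) • x = 0 := by
      rw [two]
      calc x + x = (x + md.J x) + (x - md.J x) := by abel
        _ = 0 := by rw [h1, h3, add_zero]
    exact (smul_eq_zero.mp h4).resolve_left two_ne_zero
  refine ⟨hQ, ?_⟩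
  intro h k y hDk hy
  have h1 : ((D k : H) : ℋ) = ((Q h : H) : ℋ) := by rw [hDk]
  rw [hDf, hQ, two, ← hy, two] at h1
  have h2 := hinj (Complex.I • (k : ℋ) - (md.W y + md.W y)) (by
    simp only [map_sub, map_add, map_smul, md.WR_comm, smul_sub, smul_add] at h1 ⊢
    rw [← sub_eq_zero] at h1 ⊢
    rw [← h1]
    abel)
  have h3 : Complex.I • (k : ℋ) = md.W y + md.W y := sub_eq_zero.mp h2
  have h4 := congrArg (fun z => Complex.I • z) h3
  simp only [smul_smul, Complex.I_mul_I, neg_smul, one_smul, smul_add] at h4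
  rw [two, ← h4, neg_neg]
end
end

section
/- Let H ⊆ ℋ be a factorial standard subspace with polariser D_H. Then E_H E_{H'}|_H = 1 + D_H² as bounded real-linear operators on H. Combined with D_H² = −E_H E_{iH}|_H, this yields the identity E_H E_{H'}|_H + E_H E_{iH}|_H = 1 on H. -/
/-!
Statement 5: For a factorial standard subspace `H ⊆ ℋ` with polariser `D_H`:
`E_H E_{H'}|_H = 1 + D_H²`, and combined with `D_H² = -E_H E_{iH}|_H` this gives
`E_H E_{H'}|_H + E_H E_{iH}|_H = 1` on `H`.
-/

open scoped InnerProductSpace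

attribute [local instance] InnerProductSpace.complexToReal

noncomputable section

/-- Real-orthogonal projection onto the closed real subspace `K`. -/
def IsOrthProj {ℋ : Type} [NormedAddCommGroup ℋ] [InnerProductSpace ℂ ℋ]
    (K : Submodule ℝ ℋ) (E : ℋ →ₗ[ℝ] ℋ) : Prop :=
  (∀ x : ℋ, E x ∈ K) ∧ (∀ x ∈ K, E x = x) ∧ ∀ (x : ℋ), ∀ k ∈ K, ⟪x - E x, k⟫_ℝ = 0

theorem IsOrthProj.eq_of {ℋ : Type} [NormedAddCommGroup ℋ] [InnerProductSpace ℂ ℋ]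
    {K : Submodule ℝ ℋ} {E : ℋ →ₗ[ℝ] ℋ} (hE : IsOrthProj K E) {x y : ℋ} (hy : y ∈ K)
    (h : ∀ k ∈ K, ⟪x - y, k⟫_ℝ = 0) : E x = y := by
  have hm : E x - y ∈ K := K.sub_mem (hE.1 x) hy
  have h1 := h _ hm
  have h2 := hE.2.2 x _ hm
  have h3 : ⟪E x - y, E x - y⟫_ℝ = 0 := by
    have : E x - y = (x - y) - (x - E x) := by abel
    nth_rewrite 1 [this]
    rw [inner_sub_left, h1, h2, sub_zero]
  exact sub_eq_zero.1 (inner_self_eq_zero.1 h3)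

theorem mulI_apply' {ℋ : Type} [NormedAddCommGroup ℋ] [InnerProductSpace ℂ ℋ] (x : ℋ) :
    mulI ℋ x = Complex.I • x := rfl

theorem real_inner_def' {ℋ : Type} [NormedAddCommGroup ℋ] [InnerProductSpace ℂ ℋ] (x y : ℋ) :
    ⟪x, y⟫_ℝ = (⟪x, y⟫_ℂ).re := rfl

theorem real_inner_mulI_right {ℋ : Type} [NormedAddCommGroup ℋ] [InnerProductSpace ℂ ℋ]
    (x y : ℋ) : ⟪x, mulI ℋ y⟫_ℝ = -(⟪x, y⟫_ℂ).im := by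
  rw [real_inner_def', mulI_apply', inner_smul_right]
  simp

theorem real_inner_mulI_mulI {ℋ : Type} [NormedAddCommGroup ℋ] [InnerProductSpace ℂ ℋ]
    (x y : ℋ) : ⟪mulI ℋ x, mulI ℋ y⟫_ℝ = ⟪x, y⟫_ℝ := by
  rw [real_inner_def', real_inner_def', mulI_apply', mulI_apply', inner_smul_right,
    inner_smul_left]
  simp

theorem proj_sympComp_eq_one_add_polariser_sq
    {ℋ : Type} [NormedAddCommGroup ℋ] [InnerProductSpace ℂ ℋ] [CompleteSpace ℋ]
    (H : Submodule ℝ ℋ) (hH : IsClosed (H : Set ℋ))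
    (hcyc : Dense ((H ⊔ H.map (mulI ℋ) : Submodule ℝ ℋ) : Set ℋ))
    (hsep : H ⊓ H.map (mulI ℋ) = ⊥)
    (hfac : H ⊓ sympComp H = ⊥)
    (D : ↥H →L[ℝ] ↥H)
    (hD : ∀ h k : ↥H, (⟪(h : ℋ), (k : ℋ)⟫_ℂ).im = ⟪(h : ℋ), ((D k : ↥H) : ℋ)⟫_ℝ)
    (E E' E'' : ℋ →ₗ[ℝ] ℋ)
    (hE : IsOrthProj H E) (hE' : IsOrthProj (sympComp H) E')
    (hE'' : IsOrthProj (H.map (mulI ℋ)) E'') :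
    -- E_H E_{H'}|_H = 1 + D_H²
    (∀ h : ↥H, E (E' (h : ℋ)) = ((h + D (D h) : ↥H) : ℋ)) ∧
    -- D_H² = -E_H E_{iH}|_H
    (∀ h : ↥H, ((D (D h) : ↥H) : ℋ) = -(E (E'' (h : ℋ)))) ∧
    -- E_H E_{H'}|_H + E_H E_{iH}|_H = 1 on H
    (∀ h : ↥H, E (E' (h : ℋ)) + E (E'' (h : ℋ)) = (h : ℋ)) := by
  have hEi : ∀ h : ↥H, E (mulI ℋ (h : ℋ)) = -((D h : ↥H) : ℋ) := by
    intro h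
    refine hE.eq_of (H.neg_mem (D h).2) fun k hk => ?_
    have h1 := hD ⟨k, hk⟩ h
    simp only at h1
    rw [real_inner_comm, sub_neg_eq_add, inner_add_right, real_inner_mulI_right, h1]
    simp
  have hE2 : ∀ h : ↥H, E'' (h : ℋ) = mulI ℋ ((D h : ↥H) : ℋ) := by
    intro h
    refine hE''.eq_of (Submodule.mem_map_of_mem (D h).2) ?_
    rintro _ ⟨k, hk, rfl⟩
    have h1 := hD ⟨k, hk⟩ h
    simp only at h1
    have h2 : (⟪(h : ℋ), k⟫_ℂ).im = -(⟪k, (h : ℋ)⟫_ℂ).im := by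
      rw [← inner_conj_symm, Complex.conj_im]
    rw [inner_sub_left, real_inner_mulI_mulI, real_inner_mulI_right, h2, h1,
      real_inner_comm k]
    ring
  have hE1 : ∀ x : ℋ, E' x = x - E'' x := by
    intro x
    refine hE'.eq_of ?_ ?_
    · rw [sympComp, Submodule.mem_orthogonal']
      exact hE''.2.2 x
    · intro k hk
      rw [sub_sub_cancel]
      exact (Submodule.mem_orthogonal _ _).1 hk _ (hE''.1 x)
  have hA : ∀ h : ↥H, ((D (D h) : ↥H) : ℋ) = -(E (E'' (h : ℋ))) := by
    intro h
    rw [hE2, hEi, neg_neg]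
  have hB : ∀ h : ↥H, E (E' (h : ℋ)) + E (E'' (h : ℋ)) = (h : ℋ) := by
    intro h
    rw [hE1, map_sub, sub_add_cancel, hE.2.1 _ h.2]
  refine ⟨fun h => ?_, hA, hB⟩
  rw [Submodule.coe_add, hA, ← sub_eq_add_neg, eq_sub_iff_add_eq, hB]
end
end

section
/- Let H be a real Hilbert space with scalar product α and β a compatible symplectic form whose polariser D satisfies ker(D) = {0} and ker(D² + 1) = {0}. Let D = V|D| be the polar decomposition, so that V commutes with D and V² = −1. Then the operator ι = [[D, V√(1+D²)], [V√(1+D²), −D]] on H̃ = H ⊕ H is an orthogonal operator with ι² = −1, hence a complex structure, making H̃ a complex Hilbert space ℋ with inner product α̃(·,·) + i·α̃(·, ι·) where α̃ = α ⊕ α. Moreover, the map κ : h ↦ h ⊕ 0 is a one-particle structure on (H, α, β), and κ(H) is a factorial standard subspace of ℋ. -/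
/-!
Statement 6: orthogonal dilation.  Let `(H, α)` be a real Hilbert space with a
compatible symplectic form `β` whose polariser `D` (with polar decomposition
`D = V |D|`, `V² = −1`, `V` commuting with `D`) satisfies `ker D = {0}` and
`ker (D² + 1) = {0}`.  With `Q = √(1 + D²)`, the operator
`ι = [[D, V Q], [V Q, −D]]` on `H̃ = H ⊕ H` (ℓ²-direct sum) is orthogonal with
`ι² = −1`, hence a complex structure making `H̃` a complex Hilbert space `ℋ` with
inner product `α̃(·,·) + i α̃(·, ι ·)`; the map `κ : h ↦ h ⊕ 0` is a one-particle
structure on `(H, α, β)`, and `κ(H)` is a factorial standard subspace of `ℋ`.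
-/

open scoped InnerProductSpace

noncomputable section

variable {H : Type} [NormedAddCommGroup H] [InnerProductSpace ℝ H] [CompleteSpace H]

/-- The complex structure `ι = [[D, V Q], [V Q, −D]]` on `H ⊕ H` (ℓ²-sum). -/
def iotaO (D V Q : H →L[ℝ] H) (z : WithLp 2 (H × H)) : WithLp 2 (H × H) :=
  (WithLp.equiv 2 (H × H)).symm
    (D (WithLp.equiv 2 (H × H) z).1 + V (Q (WithLp.equiv 2 (H × H) z).2),
      V (Q (WithLp.equiv 2 (H × H) z).1) - D (WithLp.equiv 2 (H × H) z).2)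

/-- The embedding `κ : h ↦ h ⊕ 0`. -/
def kap (h : H) : WithLp 2 (H × H) := (WithLp.equiv 2 (H × H)).symm (h, 0)

theorem orthogonal_dilation
    (β : H → H → ℝ) (D V A Q : H →L[ℝ] H)
    -- D is the polariser of the compatible symplectic form β
    (hβD : ∀ h k : H, β h k = ⟪h, D k⟫_ℝ)
    (hDskew : ∀ h k : H, ⟪D h, k⟫_ℝ = -⟪h, D k⟫_ℝ)
    (hDnorm : ∀ h : H, ‖D h‖ ≤ ‖h‖)
    (hDinj : ∀ h : H, D h = 0 → h = 0)
    (hDsep : ∀ h : H, D (D h) + h = 0 → h = 0)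
    -- A = |D|, V the phase: D = V |D|, V² = −1, V orthogonal, V D = D V
    (hAsym : ∀ h k : H, ⟪A h, k⟫_ℝ = ⟪h, A k⟫_ℝ)
    (hApos : ∀ h : H, 0 ≤ ⟪h, A h⟫_ℝ)
    (hAsq : ∀ h : H, A (A h) = -(D (D h)))
    (hpolar : ∀ h : H, D h = V (A h))
    (hV2 : ∀ h : H, V (V h) = -h)
    (hViso : ∀ h : H, ‖V h‖ = ‖h‖)
    (hVD : ∀ h : H, V (D h) = D (V h))
    -- Q = √(1 + D²)
    (hQsym : ∀ h k : H, ⟪Q h, k⟫_ℝ = ⟪h, Q k⟫_ℝ)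
    (hQpos : ∀ h : H, 0 ≤ ⟪h, Q h⟫_ℝ)
    (hQsq : ∀ h : H, Q (Q h) = h + D (D h))
    (hQD : ∀ h : H, Q (D h) = D (Q h))
    (hQV : ∀ h : H, Q (V h) = V (Q h)) :
    -- ι is real-linear …
    (∀ z w : WithLp 2 (H × H), iotaO D V Q (z + w) = iotaO D V Q z + iotaO D V Q w) ∧
    (∀ (r : ℝ) (z : WithLp 2 (H × H)), iotaO D V Q (r • z) = r • iotaO D V Q z) ∧
    -- … orthogonal (a unitary of H̃) …
    (∀ z w : WithLp 2 (H × H), ⟪iotaO D V Q z, iotaO D V Q w⟫_ℝ = ⟪z, w⟫_ℝ) ∧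
    -- … with ι² = −1: a complex structure on H̃
    (∀ z : WithLp 2 (H × H), iotaO D V Q (iotaO D V Q z) = -z) ∧
    -- κ is a one-particle structure on (H, α, β) for the complex Hilbert space
    -- (H̃, ι) with inner product α̃(·,·) + i α̃(·, ι ·):
    -- Re ⟪κ h, κ k⟫ = α(h, k), Im ⟪κ h, κ k⟫ = α̃(κ h, ι κ k) = β(h, k),
    (∀ h k : H, ⟪kap h, kap k⟫_ℝ = ⟪h, k⟫_ℝ) ∧
    (∀ h k : H, ⟪kap h, iotaO D V Q (kap k)⟫_ℝ = β h k) ∧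
    -- κ(H) + i κ(H) is dense in H̃ (cyclicity)
    Dense {z : WithLp 2 (H × H) | ∃ a b : H, z = kap a + iotaO D V Q (kap b)} ∧
    -- κ(H) is separating: κ(H) ∩ ι κ(H) = {0}
    (∀ h k : H, kap h = iotaO D V Q (kap k) → h = 0) ∧
    -- κ(H) is factorial: κ(H) ∩ (ι κ(H))^⊥ = {0}
    (∀ h : H, (∀ k : H, ⟪iotaO D V Q (kap k), kap h⟫_ℝ = 0) → h = 0) := by
  have hVV : ∀ h k : H, ⟪V h, V k⟫_ℝ = ⟪h, k⟫_ℝ := by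
    intro h k
    have h1 := norm_add_sq_real (V h) (V k)
    have h2 := norm_add_sq_real h k
    rw [← map_add, hViso, hViso, hViso] at h1
    linarith
  have hVskew : ∀ h k : H, ⟪V h, k⟫_ℝ = -⟪h, V k⟫_ℝ := by
    intro h k
    rw [← hVV h (V k), hV2, inner_neg_right, neg_neg]
  have hVQskew : ∀ h k : H, ⟪V (Q h), k⟫_ℝ = -⟪h, V (Q k)⟫_ℝ := by
    intro h k
    rw [hVskew, hQsym, hQV]
  have hVQinj : ∀ h : H, V (Q h) = 0 → h = 0 := by
    intro h hh
    have h0 : Q h = 0 := by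
      rw [← norm_eq_zero, ← hViso, hh, norm_zero]
    apply hDsep
    rw [add_comm, ← hQsq, h0, map_zero]
  have hinner : ∀ z w : WithLp 2 (H × H), ⟪z, w⟫_ℝ = ⟪z.fst, w.fst⟫_ℝ + ⟪z.snd, w.snd⟫_ℝ :=
    fun z w => WithLp.prod_inner_apply z w
  have i1 : ∀ z, (iotaO D V Q z).fst = D z.fst + V (Q z.snd) := fun z => rfl
  have i2 : ∀ z, (iotaO D V Q z).snd = V (Q z.fst) - D z.snd := fun z => rfl
  have k1 : ∀ h : H, (kap h).fst = h := fun z => rfl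
  have k2 : ∀ h : H, (kap h).snd = 0 := fun z => rfl
  have hext : ∀ z w : WithLp 2 (H × H), z.fst = w.fst → z.snd = w.snd → z = w := by
    intro z w h1 h2
    exact (WithLp.equiv 2 (H × H)).injective (Prod.ext h1 h2)
  have hadd : ∀ z w : WithLp 2 (H × H),
      iotaO D V Q (z + w) = iotaO D V Q z + iotaO D V Q w := by
    intro z w
    apply hext
    · simp only [i1, WithLp.add_fst, WithLp.add_snd, map_add]; abel
    · simp only [i2, WithLp.add_fst, WithLp.add_snd, map_add]; abel
  have hsmul : ∀ (r : ℝ) (z : WithLp 2 (H × H)),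
      iotaO D V Q (r • z) = r • iotaO D V Q z := by
    intro r z
    apply hext
    · simp only [i1, WithLp.smul_fst, WithLp.smul_snd, map_smul, smul_add]
    · simp only [i2, WithLp.smul_fst, WithLp.smul_snd, map_smul, smul_sub]
  have hsq : ∀ z : WithLp 2 (H × H), iotaO D V Q (iotaO D V Q z) = -z := by
    intro z
    apply hext
    · simp only [i1, i2, WithLp.neg_fst, map_add, map_sub, map_neg, hQV, hV2, hQsq, hQD, hVD]; abel
    · simp only [i1, i2, WithLp.neg_snd, map_add, map_sub, map_neg, hQV, hV2, hQsq, hQD, hVD]; abel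
  have hskew : ∀ z w : WithLp 2 (H × H),
      ⟪iotaO D V Q z, w⟫_ℝ = -⟪z, iotaO D V Q w⟫_ℝ := by
    intro z w
    simp only [hinner, i1, i2, inner_add_left, inner_sub_left, inner_add_right,
      inner_sub_right, hDskew, hVQskew]
    ring
  have hkadd : ∀ a b : H, kap (a + b) = kap a + kap b := by
    intro a b
    apply hext
    · simp only [k1, WithLp.add_fst]
    · simp only [k2, WithLp.add_snd, add_zero]
  have hksmul : ∀ (r : ℝ) (a : H), kap (r • a) = r • kap a := by
    intro r a
    apply hext
    · simp only [k1, WithLp.smul_fst]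
    · simp only [k2, WithLp.smul_snd, smul_zero]
  refine ⟨hadd, hsmul, ?_, hsq, ?_, ?_, ?_, ?_, ?_⟩
  · intro z w
    rw [hskew, hsq, inner_neg_right, neg_neg]
  · intro h k
    simp only [hinner, k1, k2, inner_zero_left, add_zero]
  · intro h k
    simp only [hinner, i1, k1, k2, inner_zero_left, map_zero, add_zero, hβD]
  · let K : Submodule ℝ (WithLp 2 (H × H)) :=
      { carrier := {z : WithLp 2 (H × H) | ∃ a b : H, z = kap a + iotaO D V Q (kap b)}
        add_mem' := by
          rintro _ _ ⟨a, b, rfl⟩ ⟨c, d, rfl⟩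
          refine ⟨a + c, b + d, ?_⟩
          rw [hkadd, hkadd, hadd]; abel
        zero_mem' := by
          refine ⟨0, 0, ?_⟩
          apply hext <;> simp [i1, i2, k1, k2]
        smul_mem' := by
          rintro r _ ⟨a, b, rfl⟩
          refine ⟨r • a, r • b, ?_⟩
          rw [hksmul, hksmul, hsmul, smul_add] }
    change Dense (K : Set (WithLp 2 (H × H)))
    rw [Submodule.dense_iff_topologicalClosure_eq_top,
      Submodule.topologicalClosure_eq_top_iff, Submodule.eq_bot_iff]
    intro z hz
    rw [Submodule.mem_orthogonal] at hz
    have key : ∀ a b : H, ⟪kap a + iotaO D V Q (kap b), z⟫_ℝ = 0 :=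
      fun a b => hz _ ⟨a, b, rfl⟩
    simp only [hinner, WithLp.add_fst, WithLp.add_snd, i1, i2, k1, k2, map_zero, add_zero,
      zero_add, sub_zero] at key
    have hx : z.fst = 0 := by
      have := key z.fst 0
      simpa using this
    have hy : z.snd = 0 := by
      apply hVQinj
      have := key 0 (V (Q z.snd))
      rw [hx, inner_zero_right, zero_add, hVQskew, neg_eq_zero] at this
      exact inner_self_eq_zero.mp this
    exact hext _ _ hx hy
  · intro h k hk
    have h1 : h = D k := by
      have := congrArg (fun z : WithLp 2 (H × H) => z.fst) hk
      simpa only [i1, k1, k2, map_zero, add_zero] using this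
    have h2 : V (Q k) = 0 := by
      have := congrArg (fun z : WithLp 2 (H × H) => z.snd) hk
      simpa only [i2, k1, k2, map_zero, sub_zero] using this.symm
    rw [h1, hVQinj k h2, map_zero]
  · intro h hk
    apply hDinj
    have := hk (D h)
    simp only [hinner, i1, k1, k2, map_zero, add_zero, inner_zero_right, hDskew (D h),
      neg_eq_zero] at this
    exact inner_self_eq_zero.mp this
end
end

section
/- Let T : D(T) ⊆ ℋ → ℋ be a symplectic map. Then: (1) for every ξ ∈ D(T), iTξ ∈ D(T*) and T*iTξ = iξ; (2) ker(T) = {0}; (3) T is closable; (4) T^{-1} = −iT*i on ran(T); (5) T is bounded if and only if T* is bounded, if and only if T^{-1} is bounded. -/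
/-!
Statement 8: for a symplectic map `T : D(T) ⊆ ℋ → ℋ` (densely defined, dense range,
real-linear, preserving `Im ⟪·,·⟫`):
(1) `iTξ ∈ D(T*)` and `T* i T ξ = i ξ`; (2) `ker T = {0}`; (3) `T` is closable;
(4) `T⁻¹ = -i T* i` on `ran T`; (5) `T` bounded ↔ `T*` bounded ↔ `T⁻¹` bounded.
The adjoint is taken w.r.t. the real scalar product `Re ⟪·,·⟫`.
-/

open scoped InnerProductSpace

attribute [local instance] InnerProductSpace.complexToReal

noncomputable section

theorem aux_im {ℋ : Type} [NormedAddCommGroup ℋ] [InnerProductSpace ℂ ℋ] (x y : ℋ) :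
    ⟪Complex.I • x, y⟫_ℝ = (⟪x, y⟫_ℂ).im := by
  change (⟪Complex.I • x, y⟫_ℂ).re = _
  rw [inner_smul_left]
  simp

theorem aux_bound {ℋ : Type} [NormedAddCommGroup ℋ] [InnerProductSpace ℂ ℋ]
    (S : Set ℋ) (hS : Dense S) (x : ℋ) (K : ℝ) (hK : 0 ≤ K)
    (h : ∀ y ∈ S, ⟪x, y⟫_ℝ ≤ K * ‖y‖) : ‖x‖ ≤ K := by
  have hc : IsClosed {y : ℋ | ⟪x, y⟫_ℝ ≤ K * ‖y‖} :=
    isClosed_le (by fun_prop) (by fun_prop)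
  have h2 : x ∈ {y : ℋ | ⟪x, y⟫_ℝ ≤ K * ‖y‖} := hc.closure_subset_iff.2 h (hS x)
  have h3 : ⟪x, x⟫_ℝ ≤ K * ‖x‖ := h2
  rw [real_inner_self_eq_norm_sq] at h3
  rcases (norm_nonneg x).eq_or_lt with h0 | h0
  · rw [← h0]; exact hK
  · nlinarith

theorem symplectic_pmap_props
    {ℋ : Type} [NormedAddCommGroup ℋ] [InnerProductSpace ℂ ℋ] [CompleteSpace ℋ]
    (T : ℋ →ₗ.[ℝ] ℋ)
    (hdom : Dense (T.domain : Set ℋ))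
    (hran : Dense (Set.range fun ξ : T.domain => T ξ))
    (hsymp : ∀ ξ η : T.domain, (⟪T ξ, T η⟫_ℂ).im = (⟪(ξ : ℋ), (η : ℋ)⟫_ℂ).im) :
    -- (1) iTξ ∈ D(T*) and T* i T ξ = i ξ
    (∀ ξ : T.domain, ∃ hm : Complex.I • T ξ ∈ T.adjoint.domain,
      T.adjoint ⟨Complex.I • T ξ, hm⟩ = Complex.I • (ξ : ℋ)) ∧
    -- (2) ker T = {0}
    (∀ ξ : T.domain, T ξ = 0 → (ξ : ℋ) = 0) ∧
    -- (3) T is closable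
    T.IsClosable ∧
    -- (4) T⁻¹ = -i T* i on ran T
    (∀ ξ : T.domain, ∃ hm : Complex.I • T ξ ∈ T.adjoint.domain,
      -(Complex.I • T.adjoint ⟨Complex.I • T ξ, hm⟩) = (ξ : ℋ)) ∧
    -- (5) T bounded ↔ T* bounded ↔ T⁻¹ bounded
    ((∃ C : ℝ, ∀ ξ : T.domain, ‖T ξ‖ ≤ C * ‖(ξ : ℋ)‖) ↔
      (∃ C : ℝ, ∀ η : T.adjoint.domain, ‖T.adjoint η‖ ≤ C * ‖(η : ℋ)‖)) ∧
    ((∃ C : ℝ, ∀ ξ : T.domain, ‖T ξ‖ ≤ C * ‖(ξ : ℋ)‖) ↔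
      (∃ C : ℝ, ∀ ξ : T.domain, ‖(ξ : ℋ)‖ ≤ C * ‖T ξ‖)) := by
  have hI : ∀ x : ℋ, ‖Complex.I • x‖ = ‖x‖ := fun x => by simp [norm_smul]
  have key : ∀ ξ η : T.domain, ⟪Complex.I • (ξ : ℋ), (η : ℋ)⟫_ℝ = ⟪Complex.I • T ξ, T η⟫_ℝ := by
    intro ξ η
    rw [aux_im, aux_im, hsymp]
  have h1 : ∀ ξ : T.domain, ∃ hm : Complex.I • T ξ ∈ T.adjoint.domain,
      T.adjoint ⟨Complex.I • T ξ, hm⟩ = Complex.I • (ξ : ℋ) := by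
    intro ξ
    have hm : Complex.I • T ξ ∈ T.adjoint.domain :=
      LinearPMap.mem_adjoint_domain_of_exists _ ⟨Complex.I • (ξ : ℋ), key ξ⟩
    exact ⟨hm, LinearPMap.adjoint_apply_eq hdom _ (key ξ)⟩
  have hTinv : (∃ C : ℝ, ∀ ξ : T.domain, ‖T ξ‖ ≤ C * ‖(ξ : ℋ)‖) →
      (∃ C : ℝ, ∀ ξ : T.domain, ‖(ξ : ℋ)‖ ≤ C * ‖T ξ‖) := by
    rintro ⟨C, hC⟩
    refine ⟨|C|, fun ξ => ?_⟩
    rw [← hI (ξ : ℋ)]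
    refine aux_bound _ hdom _ _ (by positivity) fun y hy => ?_
    rw [key ξ ⟨y, hy⟩]
    calc _ ≤ ‖Complex.I • T ξ‖ * ‖T ⟨y, hy⟩‖ := real_inner_le_norm _ _
      _ ≤ ‖T ξ‖ * (|C| * ‖y‖) := by
        rw [hI]
        have := (hC ⟨y, hy⟩).trans (mul_le_mul_of_nonneg_right (le_abs_self C) (norm_nonneg y))
        gcongr
      _ = _ := by ring
  have hinvT : (∃ C : ℝ, ∀ ξ : T.domain, ‖(ξ : ℋ)‖ ≤ C * ‖T ξ‖) →
      (∃ C : ℝ, ∀ ξ : T.domain, ‖T ξ‖ ≤ C * ‖(ξ : ℋ)‖) := by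
    rintro ⟨C, hC⟩
    refine ⟨|C|, fun ξ => ?_⟩
    rw [← hI (T ξ)]
    refine aux_bound _ hran _ _ (by positivity) ?_
    rintro _ ⟨η, rfl⟩
    change ⟪Complex.I • T ξ, T η⟫_ℝ ≤ |C| * ‖(ξ : ℋ)‖ * ‖T η‖
    rw [← key ξ η]
    calc _ ≤ ‖Complex.I • (ξ : ℋ)‖ * ‖(η : ℋ)‖ := real_inner_le_norm _ _
      _ ≤ ‖(ξ : ℋ)‖ * (|C| * ‖T η‖) := by
        rw [hI]
        have := (hC η).trans (mul_le_mul_of_nonneg_right (le_abs_self C) (norm_nonneg (T η)))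
        gcongr
      _ = _ := by ring
  refine ⟨h1, ?_, ?_, ?_, ⟨?_, ?_⟩, hTinv, hinvT⟩
  · intro ξ h0
    have : ‖Complex.I • (ξ : ℋ)‖ ≤ 0 := by
      refine aux_bound _ hdom _ _ le_rfl fun y hy => ?_
      rw [key ξ ⟨y, hy⟩, h0]
      simp
    rw [hI] at this
    exact norm_le_zero_iff.1 this
  · refine ⟨T.graph.topologicalClosure.toLinearPMap, ?_⟩
    symm
    apply Submodule.toLinearPMap_graph_eq
    rintro ⟨a, b⟩ hab ha
    have hcl : ∀ η : T.domain, ⟪Complex.I • a, (η : ℋ)⟫_ℝ = ⟪Complex.I • b, T η⟫_ℝ := by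
      intro η
      have hc : IsClosed {p : ℋ × ℋ | ⟪Complex.I • p.1, (η : ℋ)⟫_ℝ = ⟪Complex.I • p.2, T η⟫_ℝ} :=
        isClosed_eq (by fun_prop) (by fun_prop)
      have hsub : (T.graph : Set (ℋ × ℋ)) ⊆
          {p : ℋ × ℋ | ⟪Complex.I • p.1, (η : ℋ)⟫_ℝ = ⟪Complex.I • p.2, T η⟫_ℝ} := by
        rintro ⟨p, q⟩ hp
        obtain ⟨ξ, hξ1, hξ2⟩ := T.mem_graph_iff.1 hp
        simp only at hξ1 hξ2
        subst hξ1 hξ2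
        exact key ξ η
      exact hc.closure_subset_iff.2 hsub hab
    simp only at ha
    subst ha
    have : ‖Complex.I • b‖ ≤ 0 := by
      refine aux_bound _ hran _ _ le_rfl ?_
      rintro _ ⟨η, rfl⟩
      change ⟪Complex.I • b, T η⟫_ℝ ≤ 0 * ‖T η‖
      rw [← hcl η]
      simp
    rw [hI] at this
    exact norm_le_zero_iff.1 this
  · intro ξ
    obtain ⟨hm, h⟩ := h1 ξ
    refine ⟨hm, ?_⟩
    rw [h, smul_smul]
    simp
  · rintro ⟨C, hC⟩
    refine ⟨|C|, fun η => ?_⟩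
    refine aux_bound _ hdom _ _ (by positivity) fun y hy => ?_
    have := LinearPMap.adjoint_isFormalAdjoint hdom η ⟨y, hy⟩
    simp only at this
    rw [this]
    calc _ ≤ ‖(η : ℋ)‖ * ‖T ⟨y, hy⟩‖ := real_inner_le_norm _ _
      _ ≤ ‖(η : ℋ)‖ * (|C| * ‖y‖) := by
        have := (hC ⟨y, hy⟩).trans (mul_le_mul_of_nonneg_right (le_abs_self C) (norm_nonneg y))
        gcongr
      _ = _ := by ring
  · rintro ⟨C, hC⟩
    refine hinvT ⟨C, fun ξ => ?_⟩
    obtain ⟨hm, h⟩ := h1 ξ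
    have := hC ⟨_, hm⟩
    rw [h] at this
    simpa only [hI] using this
end
end

section
/- Let H ⊆ ℋ be a factorial standard subspace with polariser D = D_H and modular conjugation J = J_H. The symplectic matrix decomposition of the complex structure i (multiplication by the imaginary unit, restricted to H + H') is i = [[D^{-1}, D^{-1}√(1+D²)J], [−J D^{-1}√(1+D²), −J D^{-1} J]]. In particular, P_{H'} i|_H = −J D^{-1}√(1+D²) as densely defined real-linear operators from H to H'. -/
/-!
Statement 9: for a factorial standard subspace `H ⊆ ℋ` with polariser `D` and modular
conjugation `J`, the symplectic matrix decomposition of the complex structure `i`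
(restricted to `H + H'`) is
`i = [[D⁻¹, D⁻¹√(1+D²) J], [−J D⁻¹√(1+D²), −J D⁻¹ J]]`;
in particular `P_{H'} i|_H = −J D⁻¹ √(1+D²)`.
Matrix entries are encoded pointwise through the (unique) decompositions
`x = g + g'` with `g ∈ H`, `g' ∈ H'`; `Q` denotes `√(1+D²)`.
-/
open scoped InnerProductSpace

attribute [local instance] InnerProductSpace.complexToReal

noncomputable section

theorem posSqrt_unique {E : Type} [NormedAddCommGroup E] [InnerProductSpace ℝ E]
    (A B : E →L[ℝ] E)
    (hA : ∀ x y : E, ⟪A x, y⟫_ℝ = ⟪x, A y⟫_ℝ) (hB : ∀ x y : E, ⟪B x, y⟫_ℝ = ⟪x, B y⟫_ℝ)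
    (hAp : ∀ x : E, 0 ≤ ⟪x, A x⟫_ℝ) (hBp : ∀ x : E, 0 ≤ ⟪x, B x⟫_ℝ)
    (hsq : ∀ x : E, A (A x) = B (B x)) (x : E) : A x = B x := by
  have hS : ((A - B : E →L[ℝ] E) : E →ₗ[ℝ] E).IsSymmetric := by
    intro x y
    simp [inner_sub_left, inner_sub_right, hA, hB]
  have hnorm := ContinuousLinearMap.norm_eq_iSup_rayleighQuotient (A - B) hS
  have horth : ∀ x : E, ⟪(A - B) x, (A + B) x⟫_ℝ = 0 := by
    intro x
    have h1 := hA x (A x)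
    have h2 := hB x (B x)
    have h3 := hsq x
    have h4 := real_inner_comm (A x) (B x)
    simp only [sub_apply, add_apply, inner_sub_left, inner_add_right]
    rw [h1, h2, h3, h4]
    ring
  have key : ‖A - B‖ = 0 := by
    by_contra hne
    have hm : 0 < ‖A - B‖ := lt_of_le_of_ne (norm_nonneg _) (Ne.symm hne)
    set m := ‖A - B‖ with hmdef
    set t := ‖A + B‖ with htdef
    have ht : 0 ≤ t := norm_nonneg _
    have main : ∀ ε : ℝ, 0 < ε → ε ≤ m / 2 → m * (m - ε) ^ 2 ≤ 2 * ε * t ^ 2 := by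
      intro ε hε hεm
      have hlt : m - ε < ⨆ x, |(A - B).rayleighQuotient x| := by
        rw [← hnorm]; linarith
      obtain ⟨x, hx⟩ := exists_lt_of_lt_ciSup hlt
      have hx0 : x ≠ 0 := by
        rintro rfl
        simp at hx
        linarith
      have hxn : 0 < ‖x‖ := norm_pos_iff.mpr hx0
      have hn : 0 < ‖x‖ ^ 2 := by positivity
      have hq : (m - ε) * ‖x‖ ^ 2 < |⟪(A - B) x, x⟫_ℝ| := by
        have : (A - B).rayleighQuotient x = ⟪(A - B) x, x⟫_ℝ / ‖x‖ ^ 2 := rfl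
        rw [this, abs_div, abs_of_pos hn, lt_div_iff₀ hn] at hx
        exact hx
      set q := ⟪(A - B) x, x⟫_ℝ with hqdef
      set p := ⟪x, (A + B) x⟫_ℝ with hpdef
      have hqe : q = ⟪x, A x⟫_ℝ - ⟪x, B x⟫_ℝ := by
        rw [hqdef, real_inner_comm]; simp [inner_sub_right]
      have hpe : p = ⟪x, A x⟫_ℝ + ⟪x, B x⟫_ℝ := by
        rw [hpdef]; simp [inner_add_right]
      have hqp : |q| ≤ p := by
        have := hAp x
        have := hBp x
        rw [abs_le]; constructor <;> linarith
      obtain ⟨σ, hσ, hσq⟩ : ∃ σ : ℝ, σ * σ = 1 ∧ |q| = σ * q := by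
        rcases abs_cases q with ⟨h, _⟩ | ⟨h, _⟩
        · exact ⟨1, by norm_num, by rw [h]; ring⟩
        · exact ⟨-1, by norm_num, by rw [h]; ring⟩
      set r := (A - B) x - (σ * m) • x with hr
      have hrT : ⟪r, (A + B) x⟫_ℝ = - (σ * m * p) := by
        rw [hr, inner_sub_left, horth, real_inner_smul_left]; ring
      have hSx : ‖(A - B) x‖ ≤ m * ‖x‖ := (A - B).le_opNorm x
      have hTx : ‖(A + B) x‖ ≤ t * ‖x‖ := (A + B).le_opNorm x
      have hrn : ‖r‖ ^ 2 ≤ 2 * m * ε * ‖x‖ ^ 2 := by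
        have h1 : ‖r‖ ^ 2 = ‖(A - B) x‖ ^ 2 - 2 * (m * |q|) + m ^ 2 * ‖x‖ ^ 2 := by
          rw [hr, norm_sub_sq_real, real_inner_smul_right, norm_smul, ← hqdef, hσq, mul_pow,
            Real.norm_eq_abs, sq_abs]
          linear_combination m ^ 2 * ‖x‖ ^ 2 * hσ
        have h2 : ‖(A - B) x‖ ^ 2 ≤ m ^ 2 * ‖x‖ ^ 2 := by
          rw [← mul_pow]; gcongr
        nlinarith
      have hmp : (m * p) ^ 2 ≤ ‖r‖ ^ 2 * (t ^ 2 * ‖x‖ ^ 2) := by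
        have h1 : (m * p) ^ 2 = ⟪r, (A + B) x⟫_ℝ ^ 2 := by
          rw [hrT]; linear_combination -(m * p) ^ 2 * hσ
        rw [h1, ← mul_pow, ← mul_pow, ← sq_abs]
        have h2 := abs_real_inner_le_norm r ((A + B) x)
        have h3 : ‖r‖ * ‖(A + B) x‖ ≤ ‖r‖ * (t * ‖x‖) := by gcongr
        gcongr
        exact h2.trans h3
      have hlow : (m * ((m - ε) * ‖x‖ ^ 2)) ^ 2 ≤ (m * p) ^ 2 := by
        have : 0 ≤ m - ε := by linarith
        gcongr
        linarith
      have hup : ‖r‖ ^ 2 * (t ^ 2 * ‖x‖ ^ 2) ≤ 2 * m * ε * ‖x‖ ^ 2 * (t ^ 2 * ‖x‖ ^ 2) := by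
        gcongr
      have hall := (hlow.trans hmp).trans hup
      have hpos : 0 < m * (‖x‖ ^ 2) ^ 2 := by positivity
      refine le_of_mul_le_mul_left ?_ hpos
      linarith
    have hε0 : 0 < min (m / 2) (m ^ 3 / (16 * (t ^ 2 + 1))) := by positivity
    have h := main _ hε0 (min_le_left _ _)
    set ε := min (m / 2) (m ^ 3 / (16 * (t ^ 2 + 1)))
    have h1 : ε ≤ m / 2 := min_le_left _ _
    have h2 : ε ≤ m ^ 3 / (16 * (t ^ 2 + 1)) := min_le_right _ _
    rw [le_div_iff₀ (by positivity)] at h2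
    have h3 : m * (m / 2) ^ 2 ≤ m * (m - ε) ^ 2 := by
      gcongr
      linarith
    have h4 : 0 < m ^ 3 := by positivity
    nlinarith
  have h0 : A - B = 0 := norm_eq_zero.mp key
  rw [sub_eq_zero.mp h0]

theorem mem_sympComp_iff {ℋ : Type} [NormedAddCommGroup ℋ] [InnerProductSpace ℂ ℋ]
    (H : Submodule ℝ ℋ) (x : ℋ) :
    x ∈ sympComp H ↔ ∀ h ∈ H, (⟪h, x⟫_ℂ).im = 0 := by
  unfold sympComp
  rw [Submodule.mem_orthogonal]
  have hre : ∀ h : ℋ, ⟪mulI ℋ h, x⟫_ℝ = (⟪h, x⟫_ℂ).im := by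
    intro h
    change (⟪Complex.I • h, x⟫_ℂ).re = _
    simp [inner_smul_left]
  constructor
  · intro hx h hh
    rw [← hre]
    exact hx _ (Submodule.mem_map_of_mem hh)
  · rintro hx _ ⟨h, hh, rfl⟩
    rw [hre]
    exact hx h hh

theorem complex_structure_symplectic_matrix
    {ℋ : Type} [NormedAddCommGroup ℋ] [InnerProductSpace ℂ ℋ] [CompleteSpace ℋ]
    (H : Submodule ℝ ℋ) (hH : IsClosed (H : Set ℋ))
    (hcyc : Dense ((H ⊔ H.map (mulI ℋ) : Submodule ℝ ℋ) : Set ℋ))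
    (hsep : H ⊓ H.map (mulI ℋ) = ⊥)
    (hfac : H ⊓ sympComp H = ⊥)
    (md : ModularData ℋ H)
    (D Q : ↥H →L[ℝ] ↥H)
    (hD : ∀ h k : ↥H, (⟪(h : ℋ), (k : ℋ)⟫_ℂ).im = ⟪(h : ℋ), ((D k : ↥H) : ℋ)⟫_ℝ)
    (hQsym : ∀ h k : ↥H, ⟪((Q h : ↥H) : ℋ), (k : ℋ)⟫_ℝ = ⟪(h : ℋ), ((Q k : ↥H) : ℋ)⟫_ℝ)
    (hQpos : ∀ h : ↥H, 0 ≤ ⟪(h : ℋ), ((Q h : ↥H) : ℋ)⟫_ℝ)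
    (hQsq : ∀ h : ↥H, Q (Q h) = h + D (D h)) :
    -- the matrix identity:  for x = h + h' ∈ H + H',
    -- i x = (D⁻¹ h + D⁻¹ Q J h') + (− J D⁻¹ Q h − J D⁻¹ J h')
    (∀ (h a b c d jh' : ↥H) (h' : ℋ), h' ∈ sympComp H → (jh' : ℋ) = md.J h' →
        D a = h → D b = Q jh' → D c = Q h → D d = jh' →
        Complex.I • ((h : ℋ) + h') =
          ((a : ℋ) + (b : ℋ)) + (-(md.J (c : ℋ)) - md.J (d : ℋ))) ∧
    -- in particular P_{H'} i|_H = − J D⁻¹ √(1+D²)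
    (∀ (h c : ↥H) (g g' : ℋ), D c = Q h → g ∈ H → g' ∈ sympComp H →
        Complex.I • (h : ℋ) = g + g' → g' = -(md.J (c : ℋ))) := by
  have Dinj : ∀ x y : ↥H, D x = D y → x = y := by
    intro x y hxy
    have hm : ((x - y : ↥H) : ℋ) ∈ sympComp H := by
      rw [mem_sympComp_iff]
      intro h hh
      have := hD ⟨h, hh⟩ (x - y)
      rw [map_sub, hxy, sub_self] at this
      simpa using this
    have h2 : ((x - y : ↥H) : ℋ) ∈ H ⊓ sympComp H := ⟨(x - y).2, hm⟩
    rw [hfac, Submodule.mem_bot] at h2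
    exact sub_eq_zero.mp (by exact_mod_cast h2)
  -- `W` preserves `H`
  have WH : ∀ x ∈ H, md.W x ∈ H := by
    intro x hx
    rw [md.memH_iff] at hx ⊢
    rw [← md.WR_comm, md.J_W, ← map_add, hx]
  have JWH : ∀ x ∈ H, md.J (md.W x) = x - md.R x := by
    intro x hx
    rw [md.memH_iff] at hx
    exact eq_sub_of_add_eq' hx
  have Jinner : ∀ x y : ℋ, ⟪md.J x, md.J y⟫_ℝ = ⟪x, y⟫_ℝ := by
    intro x y
    rw [real_inner_eq_norm_add_mul_self_sub_norm_mul_self_sub_norm_mul_self_div_two,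
      real_inner_eq_norm_add_mul_self_sub_norm_mul_self_sub_norm_mul_self_div_two,
      ← map_add, md.J_isom, md.J_isom, md.J_isom]
  have Jsym : ∀ x y : ℋ, ⟪md.J x, y⟫_ℝ = ⟪x, md.J y⟫_ℝ := by
    intro x y
    rw [← Jinner x, md.J_invol]
  have Wsym : ∀ x y : ℋ, ⟪md.W x, y⟫_ℝ = ⟪x, md.W y⟫_ℝ := by
    intro x y
    change (⟪md.W x, y⟫_ℂ).re = (⟪x, md.W y⟫_ℂ).re
    rw [md.W_sa]
  have Rsym : ∀ x y : ℋ, ⟪md.R x, y⟫_ℝ = ⟪x, md.R y⟫_ℝ := by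
    intro x y
    change (⟪md.R x, y⟫_ℂ).re = (⟪x, md.R y⟫_ℂ).re
    rw [md.R_sa]
  have Esym : ∀ x y : ℋ, ⟪md.R x + md.J (md.W x), y⟫_ℝ = ⟪x, md.R y + md.J (md.W y)⟫_ℝ := by
    intro x y
    rw [inner_add_left, inner_add_right, Rsym, Jsym, Wsym, md.J_W]
  have ER : ∀ x : ℋ, md.R x + md.J (md.W x) ∈ H := by
    intro x
    rw [md.memH_iff]
    have h1 : md.J (md.W (md.R x)) = md.J (md.W x) - md.R (md.J (md.W x)) := by
      rw [md.WR_comm, md.J_R]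
    have h2 : md.J (md.W (md.J (md.W x))) = md.R x - md.R (md.R x) := by
      rw [← md.J_W, md.J_invol, md.W_sq]
    simp only [map_add]
    rw [h1, h2]
    abel
  -- formula for `D`
  have Dform : ∀ k : ↥H, ((D k : ↥H) : ℋ) = 
      -(Complex.I • (md.R (k : ℋ) + md.R (k : ℋ) - (k : ℋ))) := by
    intro k
    have hJ := JWH k k.2
    have e1 : md.R (-(Complex.I • (k : ℋ))) + md.J (md.W (-(Complex.I • (k : ℋ))))
        = -(Complex.I • (md.R k + md.R k - k)) := by
      simp only [map_neg, map_smul, md.J_conjI, hJ]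
      simp only [smul_sub, smul_add]
      abel
    have hmem : -(Complex.I • (md.R (k : ℋ) + md.R k - k)) ∈ H := e1 ▸ ER _
    have h0 : (D k - ⟨_, hmem⟩ : ↥H) = 0 := by
      rw [← inner_self_eq_zero (𝕜 := ℝ)]
      generalize hz : (D k - ⟨_, hmem⟩ : ↥H) = z
      have h1 : ⟪(z : ℋ), ((D k : ↥H) : ℋ)⟫_ℝ = ⟪(z : ℋ), -(Complex.I • (k : ℋ))⟫_ℝ := by
        rw [← hD]
        change _ = (⟪(z : ℋ), -(Complex.I • (k : ℋ))⟫_ℂ).re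
        simp [inner_smul_right, inner_neg_right]
      have h2 : ⟪(z : ℋ), -(Complex.I • (md.R (k : ℋ) + md.R k - k))⟫_ℝ
          = ⟪(z : ℋ), -(Complex.I • (k : ℋ))⟫_ℝ := by
        rw [← e1, ← Esym, (md.memH_iff z).mp z.2]
      change ⟪(z : ℋ), (z : ℋ)⟫_ℝ = 0
      nth_rewrite 2 [← hz]
      rw [Submodule.coe_sub, inner_sub_right, h1, h2, sub_self]
    exact congrArg Subtype.val (sub_eq_zero.mp h0)
  -- `2W` restricted to `H`
  let V : ↥H →L[ℝ] ↥H :=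
    (((2 : ℝ) • md.W.restrictScalars ℝ).comp H.subtypeL).codRestrict H (by
      intro x
      exact H.smul_mem 2 (WH x x.2))
  have Vval : ∀ x : ↥H, ((V x : ↥H) : ℋ) = (2 : ℝ) • md.W x := fun x => rfl
  have QV : ∀ x : ↥H, Q x = V x := by
    apply posSqrt_unique Q V
    · exact hQsym
    · intro x y
      change ⟪((V x : ↥H) : ℋ), (y : ℋ)⟫_ℝ = ⟪(x : ℋ), ((V y : ↥H) : ℋ)⟫_ℝ
      rw [Vval, Vval, real_inner_smul_left, real_inner_smul_right, Wsym]
    · exact hQpos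
    · intro x
      change 0 ≤ ⟪(x : ℋ), ((V x : ↥H) : ℋ)⟫_ℝ
      rw [Vval, real_inner_smul_right]
      have : 0 ≤ ⟪(x : ℋ), md.W x⟫_ℝ := md.W_pos x
      positivity
    · intro x
      rw [hQsq]
      apply Subtype.ext
      rw [Vval, Vval, Submodule.coe_add, Dform (D x), Dform x]
      have h2 : ∀ y : ℋ, md.W ((2 : ℝ) • y) = (2 : ℝ) • md.W y := fun y => by
        rw [two_smul, two_smul, map_add]
      rw [h2, md.W_sq]
      simp only [map_neg, map_smul, map_add, map_sub, smul_neg, smul_sub, smul_add, smul_smul,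
        Complex.I_mul_I, neg_smul, one_smul, two_smul]
      abel
  -- the core identity
  have core : ∀ h a c : ↥H, D a = h → D c = Q h →
      Complex.I • (h : ℋ) = (a : ℋ) - md.J (c : ℋ) := by
    intro h a c ha hc
    have hcV : c = V a := by
      apply Dinj
      rw [hc, QV, ← ha]
      apply Subtype.ext
      rw [Vval, Dform, Dform, Vval]
      simp only [two_smul, map_neg, map_smul, map_add, map_sub, md.WR_comm, smul_neg, smul_sub,
        smul_add]
    rw [hcV, Vval, ← ha, Dform, two_smul, map_add, JWH a a.2]
    simp only [smul_neg, smul_smul, Complex.I_mul_I, neg_smul, one_smul]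
    abel
  refine ⟨?_, ?_⟩
  · intro h a b c d jh' h' hh' hj ha hb hc hd
    have h1 := core h a c ha hc
    have h2 := core jh' d b hd hb
    have h3 : Complex.I • h' = -(md.J (Complex.I • (jh' : ℋ))) := by
      rw [md.J_conjI, hj, md.J_invol, neg_neg]
    rw [smul_add, h1, h3, h2, map_sub, md.J_invol]
    abel
  · intro h c g g' hc hg hg' hi
    have hDg : D ⟨g, hg⟩ = h := by
      rw [← sub_eq_zero, ← inner_self_eq_zero (𝕜 := ℝ)]
      generalize hz : D ⟨g, hg⟩ - h = z
      change ⟪(z : ℋ), (z : ℋ)⟫_ℝ = 0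
      nth_rewrite 2 [← hz]
      rw [Submodule.coe_sub, inner_sub_right, ← hD]
      have h1 := (mem_sympComp_iff H g').mp hg' z z.2
      have h2 : (⟪(z : ℋ), Complex.I • (h : ℋ)⟫_ℂ).im = ⟪(z : ℋ), (h : ℋ)⟫_ℝ := by
        change _ = (⟪(z : ℋ), (h : ℋ)⟫_ℂ).re
        simp [inner_smul_right]
      rw [← h2, hi, inner_add_right, Complex.add_im, h1]
      simp
    have h1 := core h ⟨g, hg⟩ c hDg hc
    rw [hi] at h1
    have : g + g' = g + -(md.J (c : ℋ)) := by rw [h1]; exact sub_eq_add_neg _ _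
    exact add_left_cancel this
end
end

section
/- Let H ⊆ ℋ be a factorial standard subspace and C : H + H' → H + H' a real-linear map such that iCi = C, with symplectic matrix entries C_{jk}. Then, with D = D_H and J = J_H: E_H C|_H = C₁₁ + √(1+D²) J C₂₁; E_H C i|_{H'} = D C₁₂; E_{H'} i C|_H = J D J C₂₁; and E_{H'} C|_{H'} = J√(1+D²) C₁₂ + C₂₂. -/
/-!
Statement 11: let `C : H + H' → H + H'` be real-linear with `i C i = C` (equivalently,
`C` anticommutes with `i` on its domain), with symplectic matrix entries `C₁₁ = P_H C|_H`,
`C₁₂ = P_H C|_{H'}`, `C₂₁ = P_{H'} C|_H`, `C₂₂ = P_{H'} C|_{H'}`.  Then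
`E_H C|_H = C₁₁ + √(1+D²) J C₂₁`, `E_H C i|_{H'} = D C₁₂`,
`E_{H'} i C|_H = J D J C₂₁`, `E_{H'} C|_{H'} = J √(1+D²) C₁₂ + C₂₂`.
Matrix entries are encoded pointwise via decompositions `C x = u + v`, `u ∈ H`, `v ∈ H'`.
-/
open scoped InnerProductSpace

attribute [local instance] InnerProductSpace.complexToReal

noncomputable section

section helpers

variable {V : Type*} [NormedAddCommGroup V] [InnerProductSpace ℝ V]

/-- Riesz iteration. -/
def rieszSeq (N : V →ₗ[ℝ] V) : ℕ → (V →ₗ[ℝ] V)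
  | 0 => N
  | n + 1 => rieszSeq N n - (rieszSeq N n) ∘ₗ (rieszSeq N n)

theorem rieszSeq_succ (N : V →ₗ[ℝ] V) (n : ℕ) (x : V) :
    rieszSeq N (n + 1) x = rieszSeq N n x - rieszSeq N n (rieszSeq N n x) := rfl

theorem rieszSeq_props (N Q : V →ₗ[ℝ] V)
    (hs : ∀ x y, ⟪N x, y⟫_ℝ = ⟪x, N y⟫_ℝ) (hp : ∀ x, 0 ≤ ⟪x, N x⟫_ℝ)
    (h1 : ∀ x, ⟪x, N x⟫_ℝ ≤ ⟪x, x⟫_ℝ) (hc : ∀ x, N (Q x) = Q (N x)) (n : ℕ) :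
    (∀ x y, ⟪rieszSeq N n x, y⟫_ℝ = ⟪x, rieszSeq N n y⟫_ℝ) ∧
    (∀ x, 0 ≤ ⟪x, rieszSeq N n x⟫_ℝ) ∧ (∀ x, ⟪x, rieszSeq N n x⟫_ℝ ≤ ⟪x, x⟫_ℝ) ∧
    (∀ x, rieszSeq N n (Q x) = Q (rieszSeq N n x)) := by
  induction n with
  | zero => exact ⟨hs, hp, h1, hc⟩
  | succ n ih =>
    obtain ⟨is, ip, i1, ic⟩ := ih
    refine ⟨?_, ?_, ?_, ?_⟩
    · intro x y
      simp only [rieszSeq_succ, inner_sub_left, inner_sub_right, is]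
    · intro x
      have a := ip (x - rieszSeq N n x)
      have b := i1 (rieszSeq N n x)
      simp only [rieszSeq_succ, map_sub, inner_sub_left, inner_sub_right, is] at a b ⊢
      linarith
    · intro x
      have a := i1 x
      have b : 0 ≤ ⟪rieszSeq N n x, rieszSeq N n x⟫_ℝ := real_inner_self_nonneg
      simp only [rieszSeq_succ, inner_sub_right, is] at a b ⊢
      linarith
    · intro x
      simp only [rieszSeq_succ, map_sub, ic]

theorem comm_pos (N Q : V →ₗ[ℝ] V)
    (hs : ∀ x y, ⟪N x, y⟫_ℝ = ⟪x, N y⟫_ℝ) (hp : ∀ x, 0 ≤ ⟪x, N x⟫_ℝ)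
    (h1 : ∀ x, ⟪x, N x⟫_ℝ ≤ ⟪x, x⟫_ℝ) (hc : ∀ x, N (Q x) = Q (N x))
    (hQ : ∀ x, 0 ≤ ⟪x, Q x⟫_ℝ) (x : V) : 0 ≤ ⟪x, N (Q x)⟫_ℝ := by
  have P := rieszSeq_props N Q hs hp h1 hc
  have hsum : ∀ n, ∑ k ∈ Finset.range n, ‖rieszSeq N k x‖ ^ 2
      = ⟪x, N x⟫_ℝ - ⟪x, rieszSeq N n x⟫_ℝ := by
    intro n
    induction n with
    | zero => simp [rieszSeq]
    | succ n ih =>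
      rw [Finset.sum_range_succ, ih, rieszSeq_succ, inner_sub_right, ← (P n).1 x (rieszSeq N n x),
        real_inner_self_eq_norm_sq]
      ring
  have hle : ∀ n, ⟪x, rieszSeq N n (Q x)⟫_ℝ ≤ ⟪x, N (Q x)⟫_ℝ := by
    intro n
    induction n with
    | zero => simp [rieszSeq]
    | succ n ih =>
      rw [rieszSeq_succ, inner_sub_right, ← (P n).1 x (rieszSeq N n (Q x)), (P n).2.2.2]
      have := hQ (rieszSeq N n x)
      rw [(P n).2.2.2] at ih
      linarith
  have hsm : Summable (fun k => ‖rieszSeq N k x‖ ^ 2) := by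
    refine summable_of_sum_range_le (c := ⟪x, N x⟫_ℝ) (fun _ => sq_nonneg _) ?_
    intro n
    rw [hsum]
    have := (P n).2.1 x
    linarith
  have ht := hsm.tendsto_atTop_zero
  have ht2 : Filter.Tendsto (fun k => ‖rieszSeq N k x‖) Filter.atTop (nhds 0) := by
    have := (Real.continuous_sqrt.tendsto 0).comp ht
    simpa [Function.comp_def, Real.sqrt_sq] using this
  have ht3 : Filter.Tendsto (fun k => -(‖rieszSeq N k x‖ * ‖Q x‖)) Filter.atTop (nhds 0) := by
    simpa using (ht2.mul_const ‖Q x‖).neg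
  refine le_of_tendsto' ht3 ?_
  intro n
  refine le_trans ?_ (hle n)
  rw [← (P n).1]
  have := abs_real_inner_le_norm (rieszSeq N n x) (Q x)
  exact (abs_le.mp this).1

theorem pos_ker (T : V →ₗ[ℝ] V) (hs : ∀ x y, ⟪T x, y⟫_ℝ = ⟪x, T y⟫_ℝ)
    (hp : ∀ x, 0 ≤ ⟪x, T x⟫_ℝ) (x : V) (hx : ⟪x, T x⟫_ℝ = 0) : T x = 0 := by
  have key : ∀ t : ℝ, 0 ≤ ⟪T x, T (T x)⟫_ℝ * (t * t) + (2 * ⟪T x, T x⟫_ℝ) * t + 0 := by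
    intro t
    have := hp (x + t • T x)
    have e := hs x (T x)
    simp only [map_add, map_smul, inner_add_left, inner_add_right, inner_smul_left,
      inner_smul_right, hx, ← e] at this
    simp at this ⊢
    nlinarith
  have d := discrim_le_zero key
  simp only [discrim] at d
  have : ⟪T x, T x⟫_ℝ = 0 := by nlinarith
  exact inner_self_eq_zero.mp this

theorem sylvester (T Q X : V →ₗ[ℝ] V) (hTs : ∀ x y, ⟪T x, y⟫_ℝ = ⟪x, T y⟫_ℝ)
    (hTp : ∀ x, 0 ≤ ⟪x, T x⟫_ℝ) (hTi : ∀ x, T x = 0 → x = 0)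
    (hQs : ∀ x y, ⟪Q x, y⟫_ℝ = ⟪x, Q y⟫_ℝ) (hQp : ∀ x, 0 ≤ ⟪x, Q x⟫_ℝ)
    (hXs : ∀ x y, ⟪X x, y⟫_ℝ = ⟪x, X y⟫_ℝ) (hX1 : ∀ x, ‖X x‖ ≤ ‖x‖)
    (hS : ∀ x, T (X x) = -X (Q x)) (x : V) : X x = 0 := by
  have hS' : ∀ x, X (T x) = -Q (X x) := by
    intro x
    refine ext_inner_right ℝ fun y => ?_
    rw [hXs, hTs, hS, inner_neg_right, inner_neg_left, hQs, hXs]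
  have hc : ∀ x, (X ∘ₗ X) (Q x) = Q ((X ∘ₗ X) x) := by
    intro x
    have a : X (Q x) = - T (X x) := by rw [hS]; simp
    simp only [LinearMap.comp_apply]
    rw [a, map_neg, hS', neg_neg]
  have h0 := comm_pos (X ∘ₗ X) Q (fun x y => by simp [hXs])
    (fun x => by rw [LinearMap.comp_apply, ← hXs]; exact real_inner_self_nonneg)
    (fun x => by
      rw [LinearMap.comp_apply, ← hXs, real_inner_self_eq_norm_sq, real_inner_self_eq_norm_sq]
      exact pow_le_pow_left₀ (norm_nonneg _) (hX1 x) 2) hc hQp x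
  apply hTi
  apply pos_ker T hTs hTp
  have h2 := hTp (X x)
  have : ⟪X x, T (X x)⟫_ℝ = - ⟪x, (X ∘ₗ X) (Q x)⟫_ℝ := by
    rw [hS, inner_neg_right, hXs]; rfl
  linarith

theorem sqrt_unique (T Q : V →L[ℝ] V) (hTs : ∀ x y, ⟪T x, y⟫_ℝ = ⟪x, T y⟫_ℝ)
    (hTp : ∀ x, 0 ≤ ⟪x, T x⟫_ℝ) (hTi : ∀ x, T x = 0 → x = 0)
    (hQs : ∀ x y, ⟪Q x, y⟫_ℝ = ⟪x, Q y⟫_ℝ) (hQp : ∀ x, 0 ≤ ⟪x, Q x⟫_ℝ)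
    (h : ∀ x, T (T x) = Q (Q x)) (x : V) : T x = Q x := by
  set c : ℝ := (‖T - Q‖ + 1)⁻¹ with hcdef
  have hpos : 0 < ‖T - Q‖ + 1 := by positivity
  have hc : 0 < c := inv_pos.mpr hpos
  have := sylvester (T : V →ₗ[ℝ] V) (Q : V →ₗ[ℝ] V) ((c • (T - Q) : V →L[ℝ] V) : V →ₗ[ℝ] V)
    hTs hTp hTi hQs hQp
    (fun x y => by
      simp [inner_smul_left, inner_smul_right, inner_sub_left, inner_sub_right, hTs, hQs])
    (fun x => by
      have a := (T - Q).le_opNorm x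
      have e : ‖(c • (T - Q)) x‖ = c * ‖(T - Q) x‖ := by
        rw [ContinuousLinearMap.smul_apply, norm_smul, Real.norm_of_nonneg hc.le]
      change ‖(c • (T - Q)) x‖ ≤ ‖x‖
      rw [e, hcdef, inv_mul_le_iff₀ hpos]
      nlinarith [norm_nonneg x])
    (fun x => by
      simp only [ContinuousLinearMap.coe_coe, ContinuousLinearMap.smul_apply,
        ContinuousLinearMap.sub_apply, map_smul, map_sub, h]
      rw [← smul_neg]; congr 1; abel) x
  have h3 : c • (T x - Q x) = 0 := this
  rcases smul_eq_zero.mp h3 with h4 | h4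
  · exact absurd h4 hc.ne'
  · exact sub_eq_zero.mp h4

end helpers

section modular

variable {ℋ : Type} [NormedAddCommGroup ℋ] [InnerProductSpace ℂ ℋ]

theorem rinner (x y : ℋ) : ⟪x, y⟫_ℝ = (⟪x, y⟫_ℂ).re := rfl

theorem orthProj_unique {K : Submodule ℝ ℋ} {E : ℋ →ₗ[ℝ] ℋ} (hE : IsOrthProj K E)
    (x y : ℋ) (hy : y ∈ K) (h : ∀ k ∈ K, ⟪x - y, k⟫_ℝ = 0) : E x = y := by
  have hm : E x - y ∈ K := K.sub_mem (hE.1 x) hy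
  have a := hE.2.2 x _ hm
  have b := h _ hm
  have : ⟪E x - y, E x - y⟫_ℝ = 0 := by
    have e : E x - y = (x - y) - (x - E x) := by abel
    nth_rewrite 1 [e]
    rw [inner_sub_left, a, b, sub_zero]
  exact sub_eq_zero.mp (inner_self_eq_zero.mp this)

theorem J_inner {H : Submodule ℝ ℋ} (md : ModularData ℋ H) (x y : ℋ) :
    ⟪md.J x, md.J y⟫_ℝ = ⟪x, y⟫_ℝ := by
  have := md.J_isom (x + y)
  rw [real_inner_eq_norm_add_mul_self_sub_norm_mul_self_sub_norm_mul_self_div_two,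
    real_inner_eq_norm_add_mul_self_sub_norm_mul_self_sub_norm_mul_self_div_two x y,
    ← map_add, md.J_isom, md.J_isom, md.J_isom]

theorem J_sym {H : Submodule ℝ ℋ} (md : ModularData ℋ H) (x y : ℋ) :
    ⟪md.J x, y⟫_ℝ = ⟪x, md.J y⟫_ℝ := by
  rw [← J_inner md x, md.J_invol]

theorem E_formula {H : Submodule ℝ ℋ} (md : ModularData ℋ H) {E : ℋ →ₗ[ℝ] ℋ}
    (hE : IsOrthProj H E) (x : ℋ) : E x = md.R x + md.J (md.W x) := by
  apply orthProj_unique hE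
  · rw [md.memH_iff]
    have h1 : md.R (md.J (md.W x)) = md.J (md.W x) - md.J (md.R (md.W x)) := by
      rw [md.J_R]; abel
    rw [map_add, map_add, map_add, h1, ← md.J_W, md.J_invol, md.W_sq, md.WR_comm]
    abel
  · intro k hk
    have hk' := (md.memH_iff k).mp hk
    have e : ⟪md.R x + md.J (md.W x), k⟫_ℝ = ⟪x, md.R k + md.J (md.W k)⟫_ℝ := by
      rw [inner_add_left, inner_add_right, J_sym, md.J_W k]
      simp only [rinner, md.R_sa, md.W_sa]
    rw [inner_sub_left, e, hk', sub_self]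

theorem mem_symp {H : Submodule ℝ ℋ} {v : ℋ} (hv : v ∈ sympComp H) (k : ℋ) (hk : k ∈ H) :
    ⟪Complex.I • k, v⟫_ℝ = 0 := by
  have := (Submodule.mem_orthogonal _ v).mp hv (mulI ℋ k) (Submodule.mem_map_of_mem hk)
  simpa [mulI] using this

theorem E'_formula {H : Submodule ℝ ℋ} (md : ModularData ℋ H) {E E' : ℋ →ₗ[ℝ] ℋ}
    (hE : IsOrthProj H E) (hE' : IsOrthProj (sympComp H) E') (x : ℋ) :
    E' x = md.J (E (md.J x)) := by
  apply orthProj_unique hE'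
  · exact md.J_mapsH _ (hE.1 _)
  · intro k hk
    have := hE.2.2 (md.J x) (md.J k) (md.J_mapsH' k hk)
    rw [← J_sym, map_sub, md.J_invol] at this
    exact this

theorem I_symm (x y : ℋ) : ⟪Complex.I • x, y⟫_ℝ = - ⟪x, Complex.I • y⟫_ℝ := by
  simp [rinner, inner_smul_left, inner_smul_right]

theorem E_I_zero {H : Submodule ℝ ℋ} {E : ℋ →ₗ[ℝ] ℋ}
    (hE : IsOrthProj H E) {v : ℋ} (hv : v ∈ sympComp H) : E (Complex.I • v) = 0 := by
  apply orthProj_unique hE _ _ H.zero_mem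
  intro k hk
  rw [sub_zero, I_symm, real_inner_comm, mem_symp hv k hk, neg_zero]

theorem E'_I_zero {H : Submodule ℝ ℋ} {E' : ℋ →ₗ[ℝ] ℋ}
    (hE' : IsOrthProj (sympComp H) E') {u : ℋ} (hu : u ∈ H) : E' (Complex.I • u) = 0 := by
  apply orthProj_unique hE' _ _ (Submodule.zero_mem _)
  intro k hk
  rw [sub_zero, mem_symp hk u hu]

theorem E_I {H : Submodule ℝ ℋ} {E : ℋ →ₗ[ℝ] ℋ} (hE : IsOrthProj H E) (D : ↥H →L[ℝ] ↥H)
    (hD : ∀ h k : ↥H, (⟪(h : ℋ), (k : ℋ)⟫_ℂ).im = ⟪(h : ℋ), ((D k : ↥H) : ℋ)⟫_ℝ) (u : H) :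
    E (Complex.I • (u : ℋ)) = -((D u : H) : ℋ) := by
  apply orthProj_unique hE _ _ (H.neg_mem (D u).2)
  intro k hk
  have := hD ⟨k, hk⟩ u
  rw [sub_neg_eq_add, inner_add_left, real_inner_comm k, real_inner_comm k, ← this]
  simp [rinner, inner_smul_right]

theorem E_J {H : Submodule ℝ ℋ} (md : ModularData ℋ H) {E : ℋ →ₗ[ℝ] ℋ}
    (hE : IsOrthProj H E) (D Q : ↥H →L[ℝ] ↥H)
    (hD : ∀ h k : ↥H, (⟪(h : ℋ), (k : ℋ)⟫_ℂ).im = ⟪(h : ℋ), ((D k : ↥H) : ℋ)⟫_ℝ)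
    (hQsym : ∀ h k : ↥H, ⟪((Q h : ↥H) : ℋ), (k : ℋ)⟫_ℝ = ⟪(h : ℋ), ((Q k : ↥H) : ℋ)⟫_ℝ)
    (hQpos : ∀ h : ↥H, 0 ≤ ⟪(h : ℋ), ((Q h : ↥H) : ℋ)⟫_ℝ)
    (hQsq : ∀ h : ↥H, Q (Q h) = h + D (D h)) (k : H) :
    E (md.J (k : ℋ)) = ((Q k : H) : ℋ) := by
  have hEJ : ∀ k : H, E (md.J (k : ℋ)) = md.W (k : ℋ) + md.W (k : ℋ) := by
    intro k
    have hk := (md.memH_iff k).mp k.2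
    have h1 := congrArg md.J hk
    rw [map_add, md.J_invol, md.J_R] at h1
    rw [E_formula md hE, ← md.J_W, md.J_invol]
    have h2 : md.W (k : ℋ) = md.R (md.J (k : ℋ)) := by
      have : md.J (k:ℋ) - md.R (md.J k) + md.W k - md.J k = 0 := by rw [h1, sub_self]
      rw [← sub_eq_zero, ← this]; abel
    rw [← h2]
  have hDf : ∀ k : H, ((D k : H) : ℋ)
      = Complex.I • ((k : ℋ) - md.R (k : ℋ) - md.R (k : ℋ)) := by
    intro k
    have hk := (md.memH_iff k).mp k.2
    have h := E_I hE D hD k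
    rw [E_formula md hE, map_smul, map_smul, md.J_conjI] at h
    have h2 : md.J (md.W (k : ℋ)) = k - md.R (k : ℋ) := eq_sub_of_add_eq' hk
    rw [h2] at h
    rw [← neg_neg ((D k : H) : ℋ), ← h]
    simp only [smul_sub]
    abel
  let T0 : ℋ →L[ℝ] ℋ := (md.W + md.W).restrictScalars ℝ
  have hT0 : ∀ k : H, T0 k ∈ H := fun k => by
    have := hE.1 (md.J (k : ℋ))
    rw [hEJ] at this
    exact this
  let T : H →L[ℝ] H := (T0.comp H.subtypeL).codRestrict H hT0
  have hT : ∀ k : H, ((T k : H) : ℋ) = md.W (k : ℋ) + md.W (k : ℋ) := fun k => rfl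
  have hTT : ∀ k : H, T (T k) = k + D (D k) := by
    intro k
    apply Subtype.ext
    rw [Submodule.coe_add, hT, hT, hDf, hDf]
    simp only [map_add, map_sub, map_smul, md.W_sq, smul_sub, smul_smul, Complex.I_mul_I,
      neg_smul, one_smul]
    abel
  have hu := sqrt_unique T Q
    (fun x y => by
      simp only [Submodule.coe_inner, hT, inner_add_left, inner_add_right]
      simp only [rinner, md.W_sa])
    (fun x => by
      have := md.W_pos x
      simp only [Submodule.coe_inner, hT, inner_add_right]
      simp only [rinner]
      linarith)
    (fun x hx => by
      have h1 : md.W (x : ℋ) + md.W (x : ℋ) = 0 := by rw [← hT, hx]; rfl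
      have h2 : md.W (x : ℋ) = 0 := by
        rw [← two_smul ℝ] at h1
        exact (smul_eq_zero.mp h1).resolve_left two_ne_zero
      have h3 := md.W_sq x
      rw [h2, map_zero, ← map_sub] at h3
      have h4 := md.R_inj _ h3.symm
      have h5 := md.oneSubR_inj x (sub_eq_zero.mp h4).symm
      exact Subtype.ext h5)
    hQsym hQpos (fun x => by rw [hTT, hQsq]) k
  rw [hEJ, ← hT, hu]

end modular

theorem anticommuting_operator_matrix_relations
    {ℋ : Type} [NormedAddCommGroup ℋ] [InnerProductSpace ℂ ℋ] [CompleteSpace ℋ]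
    (H : Submodule ℝ ℋ) (hH : IsClosed (H : Set ℋ))
    (hcyc : Dense ((H ⊔ H.map (mulI ℋ) : Submodule ℝ ℋ) : Set ℋ))
    (hsep : H ⊓ H.map (mulI ℋ) = ⊥)
    (hfac : H ⊓ sympComp H = ⊥)
    (md : ModularData ℋ H)
    (D Q : ↥H →L[ℝ] ↥H)
    (hD : ∀ h k : ↥H, (⟪(h : ℋ), (k : ℋ)⟫_ℂ).im = ⟪(h : ℋ), ((D k : ↥H) : ℋ)⟫_ℝ)
    (hQsym : ∀ h k : ↥H, ⟪((Q h : ↥H) : ℋ), (k : ℋ)⟫_ℝ = ⟪(h : ℋ), ((Q k : ↥H) : ℋ)⟫_ℝ)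
    (hQpos : ∀ h : ↥H, 0 ≤ ⟪(h : ℋ), ((Q h : ↥H) : ℋ)⟫_ℝ)
    (hQsq : ∀ h : ↥H, Q (Q h) = h + D (D h))
    (C : ↥(H ⊔ sympComp H) →ₗ[ℝ] ↥(H ⊔ sympComp H))
    -- i C i = C, i.e. C (i x) = − i (C x) whenever x, i x ∈ H + H'
    (hC : ∀ x y : ↥(H ⊔ sympComp H), (y : ℋ) = Complex.I • (x : ℋ) →
        (C y : ℋ) = -(Complex.I • (C x : ℋ)))
    (E E' : ℋ →ₗ[ℝ] ℋ)
    (hE : IsOrthProj H E) (hE' : IsOrthProj (sympComp H) E') :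
    -- E_H C|_H = C₁₁ + √(1+D²) J C₂₁
    (∀ (x : ↥(H ⊔ sympComp H)) (u jv : ↥H) (v : ℋ), (x : ℋ) ∈ H → v ∈ sympComp H →
        (C x : ℋ) = (u : ℋ) + v → (jv : ℋ) = md.J v →
        E (C x : ℋ) = (u : ℋ) + ((Q jv : ↥H) : ℋ)) ∧
    -- E_H C i|_{H'} = D C₁₂
    (∀ (x y : ↥(H ⊔ sympComp H)) (u : ↥H) (v : ℋ), (y : ℋ) ∈ sympComp H →
        (x : ℋ) = Complex.I • (y : ℋ) → v ∈ sympComp H →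
        (C y : ℋ) = (u : ℋ) + v → E (C x : ℋ) = ((D u : ↥H) : ℋ)) ∧
    -- E_{H'} i C|_H = J D J C₂₁
    (∀ (x : ↥(H ⊔ sympComp H)) (u jv : ↥H) (v : ℋ), (x : ℋ) ∈ H → v ∈ sympComp H →
        (C x : ℋ) = (u : ℋ) + v → (jv : ℋ) = md.J v →
        E' (Complex.I • (C x : ℋ)) = md.J ((D jv : ↥H) : ℋ)) ∧
    -- E_{H'} C|_{H'} = J √(1+D²) C₁₂ + C₂₂
    (∀ (x : ↥(H ⊔ sympComp H)) (u : ↥H) (v : ℋ), (x : ℋ) ∈ sympComp H →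
        v ∈ sympComp H → (C x : ℋ) = (u : ℋ) + v →
        E' (C x : ℋ) = md.J ((Q u : ↥H) : ℋ) + v) := by
  have hEJ := E_J md hE D Q hD hQsym hQpos hQsq
  refine ⟨?_, ?_, ?_, ?_⟩
  · intro x u jv v _ hv hCx hj
    have hvJ : v = md.J (jv : ℋ) := by rw [hj, md.J_invol]
    rw [hCx, map_add, hE.2.1 _ u.2, hvJ, hEJ]
  · intro x y u v _ hx hv hCy
    rw [hC y x hx, hCy, smul_add, map_neg, map_add, E_I_zero hE hv, E_I hE D hD]
    simp
  · intro x u jv v _ hv hCx hj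
    rw [hCx, smul_add, map_add, E'_I_zero hE' u.2, zero_add, E'_formula md hE hE',
      md.J_conjI, ← hj, map_neg, E_I hE D hD, neg_neg]
  · intro x u v _ hv hCx
    rw [hCx, map_add, hE'.2.1 v hv, E'_formula md hE hE', hEJ]
end
end

section
/- Let H_k ⊆ ℋ_k be factorial standard subspaces (k = 1,2) and T : H₁ → H₂ a symplectic bijection. Define T̃ : H₁ + H₁' → H₂ + H₂' by T̃(h + J₁k) = Th + J₂Tk for h,k ∈ H₁, i.e. T̃ = T P_{H₁} + J₂ T J₁ (1 − P_{H₁}). If the operator T̃ i₁ − i₂ T̃, defined on D(T̃) ∩ i₁ D(T̃), is bounded and densely defined, then T̃ is bounded. -/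
/-!
Statement 14: let `H_k ⊆ ℋ_k` be factorial standard subspaces, `T : H₁ → H₂` a
symplectic bijection, and `T̃ : H₁ + H₁' → H₂ + H₂'`, `T̃ (h + J₁ k) = T h + J₂ (T k)`.
If `T̃ i₁ − i₂ T̃` (defined on `D(T̃) ∩ i₁ D(T̃)`) is bounded and densely defined, then
`T̃` is bounded.
-/
open scoped InnerProductSpace

attribute [local instance] InnerProductSpace.complexToReal

noncomputable section

section Helpers

variable {ℋ : Type} [NormedAddCommGroup ℋ] [InnerProductSpace ℂ ℋ]

theorem aux_im_eq (x y : ℋ) : (⟪x, y⟫_ℂ).im = (⟪Complex.I • x, y⟫_ℂ).re := by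
  rw [inner_smul_left]; simp

theorem aux_re_J {H : Submodule ℝ ℋ} (md : ModularData ℋ H) (x y : ℋ) :
    (⟪md.J x, md.J y⟫_ℂ).re = (⟪x, y⟫_ℂ).re := by
  have h1 := norm_add_sq (𝕜 := ℂ) (md.J x) (md.J y)
  have h2 := norm_add_sq (𝕜 := ℂ) x y
  rw [← map_add, md.J_isom, md.J_isom, md.J_isom] at h1
  simp only [RCLike.re_to_complex] at h1 h2
  linarith

theorem aux_im_J {H : Submodule ℝ ℋ} (md : ModularData ℋ H) (x y : ℋ) :
    (⟪md.J x, md.J y⟫_ℂ).im = -(⟪x, y⟫_ℂ).im := by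
  rw [aux_im_eq (md.J x) (md.J y), aux_im_eq x y, ← aux_re_J md (Complex.I • x) y, md.J_conjI, inner_neg_left,
    Complex.neg_re, neg_neg]

theorem aux_mem_sympComp (H : Submodule ℝ ℋ) (x : ℋ) :
    x ∈ sympComp H ↔ ∀ h ∈ H, (⟪h, x⟫_ℂ).im = 0 := by
  unfold sympComp
  rw [Submodule.mem_orthogonal]
  constructor
  · intro hx h hh
    have := hx (mulI ℋ h) (Submodule.mem_map_of_mem hh)
    rw [aux_im_eq]
    exact this
  · rintro hx _ ⟨h, hh, rfl⟩
    have := hx h hh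
    rw [aux_im_eq] at this
    exact this

theorem aux_nondeg {H : Submodule ℝ ℋ} (md : ModularData ℋ H)
    (hfac : H ⊓ sympComp H = ⊥) (w : ℋ)
    (h1 : ∀ h ∈ H, (⟪h, w⟫_ℂ).im = 0) (h2 : ∀ h ∈ H, (⟪md.J h, w⟫_ℂ).im = 0) : w = 0 := by
  have hw : w ∈ sympComp H := (aux_mem_sympComp H w).2 h1
  have hJw : md.J w ∈ sympComp H := by
    refine (aux_mem_sympComp H _).2 fun h hh => ?_
    have := aux_im_J md (md.J h) w
    rw [md.J_invol, h2 h hh] at this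
    simpa using this
  have hw' : w ∈ H := by
    have := md.J_mapsH' _ hJw
    rwa [md.J_invol] at this
  have : w ∈ H ⊓ sympComp H := ⟨hw', hw⟩
  rw [hfac] at this
  exact (Submodule.mem_bot ℝ).1 this

theorem aux_im_sum {H : Submodule ℝ ℋ} (md : ModularData ℋ H) {a b c d : ℋ}
    (ha : a ∈ H) (hb : b ∈ H) (hc : c ∈ H) (hd : d ∈ H) :
    (⟪a + md.J b, c + md.J d⟫_ℂ).im = (⟪a, c⟫_ℂ).im - (⟪b, d⟫_ℂ).im := by
  have h1 := (aux_mem_sympComp H _).1 (md.J_mapsH d hd) a ha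
  have h2 := (aux_mem_sympComp H _).1 (md.J_mapsH b hb) c hc
  have h3 : (⟪md.J b, c⟫_ℂ).im = 0 := by
    rw [← inner_conj_symm, Complex.conj_im, h2, neg_zero]
  rw [inner_add_left, inner_add_right, inner_add_right]
  simp only [Complex.add_im]
  rw [h1, h3, aux_im_J]
  ring

end Helpers

theorem tilde_bounded_of_commutator_bounded
    {ℋ₁ ℋ₂ : Type}
    [NormedAddCommGroup ℋ₁] [InnerProductSpace ℂ ℋ₁] [CompleteSpace ℋ₁]
    [NormedAddCommGroup ℋ₂] [InnerProductSpace ℂ ℋ₂] [CompleteSpace ℋ₂]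
    (H₁ : Submodule ℝ ℋ₁) (H₂ : Submodule ℝ ℋ₂)
    (hH₁ : IsClosed (H₁ : Set ℋ₁)) (hH₂ : IsClosed (H₂ : Set ℋ₂))
    (hcyc₁ : Dense ((H₁ ⊔ H₁.map (mulI ℋ₁) : Submodule ℝ ℋ₁) : Set ℋ₁))
    (hcyc₂ : Dense ((H₂ ⊔ H₂.map (mulI ℋ₂) : Submodule ℝ ℋ₂) : Set ℋ₂))
    (hsep₁ : H₁ ⊓ H₁.map (mulI ℋ₁) = ⊥) (hsep₂ : H₂ ⊓ H₂.map (mulI ℋ₂) = ⊥)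
    (hfac₁ : H₁ ⊓ sympComp H₁ = ⊥) (hfac₂ : H₂ ⊓ sympComp H₂ = ⊥)
    (md₁ : ModularData ℋ₁ H₁) (md₂ : ModularData ℋ₂ H₂)
    -- T : H₁ → H₂ is a symplectic bijection (a priori not bounded)
    (T : ↥H₁ ≃ₗ[ℝ] ↥H₂)
    (hTsymp : ∀ h k : ↥H₁,
      (⟪((T h : ↥H₂) : ℋ₂), ((T k : ↥H₂) : ℋ₂)⟫_ℂ).im = (⟪(h : ℋ₁), (k : ℋ₁)⟫_ℂ).im)
    -- T̃ i₁ − i₂ T̃ is bounded on D(T̃) ∩ i₁ D(T̃) …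
    (hbd : ∃ M : ℝ, ∀ h k h₂ k₂ : ↥H₁,
      Complex.I • ((h : ℋ₁) + md₁.J (k : ℋ₁)) = (h₂ : ℋ₁) + md₁.J (k₂ : ℋ₁) →
      ‖(((T h₂ : ↥H₂) : ℋ₂) + md₂.J ((T k₂ : ↥H₂) : ℋ₂))
          - Complex.I • (((T h : ↥H₂) : ℋ₂) + md₂.J ((T k : ↥H₂) : ℋ₂))‖
        ≤ M * ‖(h : ℋ₁) + md₁.J (k : ℋ₁)‖)
    -- … and densely defined
    (hdense : Dense {x : ℋ₁ | ∃ h k h₂ k₂ : ↥H₁,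
      x = (h : ℋ₁) + md₁.J (k : ℋ₁) ∧
      Complex.I • x = (h₂ : ℋ₁) + md₁.J (k₂ : ℋ₁)}) :
    -- then T̃ is bounded
    ∃ M : ℝ, ∀ h k : ↥H₁,
      ‖((T h : ↥H₂) : ℋ₂) + md₂.J ((T k : ↥H₂) : ℋ₂)‖
        ≤ M * ‖(h : ℋ₁) + md₁.J (k : ℋ₁)‖ := by
  obtain ⟨M, hM⟩ := hbd
  -- the map (h, k) ↦ T̃ (h + J k) is symplectic
  have hsymp : ∀ h k h' k' : ↥H₁,
      (⟪((T h : ↥H₂) : ℋ₂) + md₂.J ((T k : ↥H₂) : ℋ₂),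
        ((T h' : ↥H₂) : ℋ₂) + md₂.J ((T k' : ↥H₂) : ℋ₂)⟫_ℂ).im =
      (⟪(h : ℋ₁) + md₁.J (k : ℋ₁), (h' : ℋ₁) + md₁.J (k' : ℋ₁)⟫_ℂ).im := by
    intro h k h' k'
    rw [aux_im_sum md₂ (T h).2 (T k).2 (T h').2 (T k').2, aux_im_sum md₁ h.2 k.2 h'.2 k'.2,
      hTsymp, hTsymp]
  have hself : ∀ {ℋ : Type} [NormedAddCommGroup ℋ] [InnerProductSpace ℂ ℋ] (x : ℋ),
      (⟪x, Complex.I • x⟫_ℂ).im = ‖x‖ ^ 2 := by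
    intro ℋ _ _ x
    rw [inner_smul_right, inner_self_eq_norm_sq_to_K, Complex.I_mul_im]
    simp [← Complex.ofReal_pow]
  -- the bound on the dense domain
  have hE : ∀ h k h₂ k₂ : ↥H₁,
      Complex.I • ((h : ℋ₁) + md₁.J (k : ℋ₁)) = (h₂ : ℋ₁) + md₁.J (k₂ : ℋ₁) →
      ‖((T h : ↥H₂) : ℋ₂) + md₂.J ((T k : ↥H₂) : ℋ₂)‖
        ≤ (|M| + 1) * ‖(h : ℋ₁) + md₁.J (k : ℋ₁)‖ := by
    intro h k h₂ k₂ hI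
    have hb := hM h k h₂ k₂ hI
    have hs := hsymp h k h₂ k₂
    rw [← hI, hself] at hs
    generalize ((T h : ↥H₂) : ℋ₂) + md₂.J ((T k : ↥H₂) : ℋ₂) = y at *
    generalize ((T h₂ : ↥H₂) : ℋ₂) + md₂.J ((T k₂ : ↥H₂) : ℋ₂) = y₂ at *
    generalize (h : ℋ₁) + md₁.J (k : ℋ₁) = x at *
    have h1 := hself y
    have h2 : (⟪y, y₂ - Complex.I • y⟫_ℂ).im = ‖x‖ ^ 2 - ‖y‖ ^ 2 := by
      rw [inner_sub_right, Complex.sub_im, hs, h1]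
    have h3 : |(⟪y, y₂ - Complex.I • y⟫_ℂ).im| ≤ ‖y‖ * ‖y₂ - Complex.I • y‖ :=
      (Complex.abs_im_le_norm _).trans (norm_inner_le_norm _ _)
    rw [h2] at h3
    have h4 := (abs_le.1 h3).1
    have h5 : ‖y₂ - Complex.I • y‖ ≤ |M| * ‖x‖ :=
      hb.trans (mul_le_mul_of_nonneg_right (le_abs_self M) (norm_nonneg x))
    have h6 : ‖y‖ * ‖y₂ - Complex.I • y‖ ≤ ‖y‖ * (|M| * ‖x‖) :=
      mul_le_mul_of_nonneg_left h5 (norm_nonneg y)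
    have h7 : 0 ≤ |M| := abs_nonneg M
    have hx := norm_nonneg x
    have hy := norm_nonneg y
    by_contra hlt
    push Not at hlt
    have h8 : ‖x‖ ≤ ‖y‖ := by nlinarith [mul_nonneg h7 hx]
    have h9 : 0 < ‖y‖ := lt_of_le_of_lt (by positivity) hlt
    nlinarith [mul_lt_mul_of_pos_left hlt h9, mul_le_mul_of_nonneg_left h8 hx]
  refine ⟨|M| + 1, fun h k => ?_⟩
  obtain ⟨x, hxE, hx⟩ := mem_closure_iff_seq_limit.1 (hdense ((h : ℋ₁) + md₁.J (k : ℋ₁)))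
  choose a b c d hab hcd using hxE
  have hab' : ∀ n, x n = (a n : ℋ₁) + md₁.J (b n : ℋ₁) := hab
  set y : ℕ → ℋ₂ := fun n => ((T (a n) : ↥H₂) : ℋ₂) + md₂.J ((T (b n) : ↥H₂) : ℋ₂) with hy
  have hyb : ∀ n, ‖y n‖ ≤ (|M| + 1) * ‖x n‖ := by
    intro n
    have := hE (a n) (b n) (c n) (d n) (by rw [← hab' n]; exact hcd n)
    rwa [← hab' n] at this
  have hyd : ∀ n m, ‖y n - y m‖ ≤ (|M| + 1) * ‖x n - x m‖ := by
    intro n m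
    have e1 : x n - x m = ((a n - a m : ↥H₁) : ℋ₁) + md₁.J ((b n - b m : ↥H₁) : ℋ₁) := by
      rw [hab' n, hab' m]; push_cast; rw [map_sub]; abel
    have e2 : Complex.I • (x n - x m)
        = ((c n - c m : ↥H₁) : ℋ₁) + md₁.J ((d n - d m : ↥H₁) : ℋ₁) := by
      rw [smul_sub, hcd n, hcd m]; push_cast; rw [map_sub]; abel
    have := hE (a n - a m) (b n - b m) (c n - c m) (d n - d m) (by rw [← e1]; exact e2)
    rw [← e1] at this
    convert this using 2
    simp only [hy, map_sub]
    push_cast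
    rw [map_sub]; abel
  have hK : 0 < |M| + 1 := by positivity
  have hcau : CauchySeq y := by
    rw [Metric.cauchySeq_iff]
    intro ε hε
    obtain ⟨N, hN⟩ := Metric.cauchySeq_iff.1 hx.cauchySeq (ε / (|M| + 1)) (by positivity)
    refine ⟨N, fun m hm n hn => ?_⟩
    have h1 := hN m hm n hn
    rw [dist_eq_norm, lt_div_iff₀ hK] at h1
    rw [dist_eq_norm]
    nlinarith [hyd m n]
  obtain ⟨z, hz⟩ := cauchySeq_tendsto_of_complete hcau
  -- the graph of T̃ is closed
  have hzeq : ∀ p q : ↥H₁,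
      (⟪((T p : ↥H₂) : ℋ₂) + md₂.J ((T q : ↥H₂) : ℋ₂),
        z - (((T h : ↥H₂) : ℋ₂) + md₂.J ((T k : ↥H₂) : ℋ₂))⟫_ℂ).im = 0 := by
    intro p q
    have t1 := (Complex.continuous_im.tendsto _).comp
      ((tendsto_const_nhds (x := ((T p : ↥H₂) : ℋ₂) + md₂.J ((T q : ↥H₂) : ℋ₂))).inner
        (𝕜 := ℂ) hz)
    have t2 := (Complex.continuous_im.tendsto _).comp
      ((tendsto_const_nhds (x := (p : ℋ₁) + md₁.J (q : ℋ₁))).inner (𝕜 := ℂ) hx)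
    have t3 := tendsto_nhds_unique (t1.congr fun n => by
      simp only [Function.comp_apply, hy]
      rw [hsymp, ← hab' n]) t2
    rw [inner_sub_right, Complex.sub_im, hsymp, t3, sub_self]
  have hz0 := aux_nondeg md₂ hfac₂ (z - (((T h : ↥H₂) : ℋ₂) + md₂.J ((T k : ↥H₂) : ℋ₂)))
    (fun g hg => by
      have := hzeq (T.symm ⟨g, hg⟩) 0
      simpa using this)
    (fun g hg => by
      have := hzeq 0 (T.symm ⟨g, hg⟩)
      simpa using this)
  rw [← sub_eq_zero.1 hz0]
  exact le_of_tendsto_of_tendsto' hz.norm (hx.norm.const_mul _) hyb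
end
end

section
/- Let H ⊆ ℋ be a factorial standard subspace with polariser D = D_H, let T = 1 + X be a symplectic bijection of H, and define T̂ : H + H' → H + H' by T̂(h + h') = Th + h' for h ∈ H, h' ∈ H'. Then [T̂, i] ∈ ℒ²(ℋ) if and only if all four operators X D^{-1} + D X, D X D^{-1}√(1+D²), √(1+D²) X, and √(1+D²) X D^{-1}√(1+D²) belong to ℒ²(H). In particular, if X D^{-1} ∈ ℒ²(H) then [T̂, i] ∈ ℒ²(ℋ). -/
/-!
Statement 19: let `H ⊆ ℋ` be a factorial standard subspace with polariser `D`, let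
`T = 1 + X` be a symplectic bijection of `H`, and `T̂ (h + h') = T h + h'` on `H + H'`.
Then `[T̂, i] ∈ ℒ²(ℋ)` iff the four operators
`X D⁻¹ + D X`, `D X D⁻¹ √(1+D²)`, `√(1+D²) X`, `√(1+D²) X D⁻¹ √(1+D²)`
all belong to `ℒ²(H)`.  In particular `X D⁻¹ ∈ ℒ²(H)` implies `[T̂, i] ∈ ℒ²(ℋ)`.
`Q = √(1+D²)`; densely defined operators (domains `ran D`, using `Q D = D Q`) and their
`ℒ²`-membership are encoded pointwise by bounded Hilbert–Schmidt extensions.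
-/
open scoped InnerProductSpace

attribute [local instance] InnerProductSpace.complexToReal

noncomputable section

/-- `T` is Hilbert–Schmidt with respect to the real parts of the inner products. -/
def IsHS {E F : Type} [NormedAddCommGroup E] [InnerProductSpace ℝ E]
    [NormedAddCommGroup F] [InnerProductSpace ℝ F] (T : E →L[ℝ] F) : Prop :=
  ∀ (ι : Type) (b : HilbertBasis ι ℝ E), Summable fun i => ‖T (b i)‖ ^ 2

section HS

variable {E F G : Type} [NormedAddCommGroup E] [InnerProductSpace ℝ E]
    [NormedAddCommGroup F] [InnerProductSpace ℝ F]
    [NormedAddCommGroup G] [InnerProductSpace ℝ G]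

lemma hs_parseval {ι : Type} (b : HilbertBasis ι ℝ E) (x : E) :
    ∑' i, ENNReal.ofReal (⟪b i, x⟫_ℝ ^ 2) = ENNReal.ofReal (‖x‖ ^ 2) := by
  have h := b.hasSum_inner_mul_inner x x
  have h2 : HasSum (fun i => ⟪b i, x⟫_ℝ ^ 2) (‖x‖ ^ 2) := by
    rw [real_inner_self_eq_norm_sq] at h
    refine h.congr_fun ?_ |> fun h => h
    intro i
    rw [real_inner_comm, sq]
  rw [← h2.tsum_eq, ENNReal.ofReal_tsum_of_nonneg (fun i => sq_nonneg _) h2.summable]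

lemma hs_adjoint_sum [CompleteSpace E] [CompleteSpace F] {ι κ : Type} (b : HilbertBasis ι ℝ E)
    (e : HilbertBasis κ ℝ F) (T : E →L[ℝ] F) :
    ∑' i, ENNReal.ofReal (‖T (b i)‖ ^ 2) =
      ∑' j, ENNReal.ofReal (‖ContinuousLinearMap.adjoint T (e j)‖ ^ 2) := by
  simp_rw [← hs_parseval e (T _), ← hs_parseval b (ContinuousLinearMap.adjoint T _)]
  rw [ENNReal.tsum_comm]
  refine tsum_congr fun j => tsum_congr fun i => ?_
  rw [ContinuousLinearMap.adjoint_inner_right, real_inner_comm]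

lemma hs_summable_iff {ι : Type} (f : ι → ℝ) (hf : ∀ i, 0 ≤ f i) :
    Summable f ↔ ∑' i, ENNReal.ofReal (f i) ≠ ⊤ := by
  constructor
  · intro h
    rw [← ENNReal.ofReal_tsum_of_nonneg hf h]
    exact ENNReal.ofReal_ne_top
  · intro h
    have := ENNReal.summable_toReal h
    simpa [ENNReal.toReal_ofReal, hf] using this

lemma hs_adjoint [CompleteSpace E] [CompleteSpace F] {T : E →L[ℝ] F} (hT : IsHS T) :
    IsHS (ContinuousLinearMap.adjoint T) := by
  intro κ e
  obtain ⟨w, b, -⟩ := exists_hilbertBasis ℝ E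
  have := hT _ b
  rw [hs_summable_iff _ (fun i => sq_nonneg _)] at this ⊢
  rwa [← hs_adjoint_sum b e]

lemma hs_comp_left {T : E →L[ℝ] F} (hT : IsHS T) (A : F →L[ℝ] G) : IsHS (A.comp T) := by
  intro ι b
  refine Summable.of_nonneg_of_le (fun i => sq_nonneg _) (fun i => ?_) ((hT ι b).mul_left (‖A‖ ^ 2))
  rw [← mul_pow]
  gcongr
  exact A.le_opNorm _

lemma hs_comp_right [CompleteSpace E] [CompleteSpace F] [CompleteSpace G]
    {T : F →L[ℝ] G} (hT : IsHS T) (A : E →L[ℝ] F) : IsHS (T.comp A) := by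
  have := hs_adjoint (hs_comp_left (hs_adjoint hT) (ContinuousLinearMap.adjoint A))
  rwa [ContinuousLinearMap.adjoint_comp, ContinuousLinearMap.adjoint_adjoint,
    ContinuousLinearMap.adjoint_adjoint] at this

lemma hs_neg {T : E →L[ℝ] F} (hT : IsHS T) : IsHS (-T) := by
  intro ι b
  simpa using hT ι b

lemma hs_add {S T : E →L[ℝ] F} (hS : IsHS S) (hT : IsHS T) : IsHS (S + T) := by
  intro ι b
  refine Summable.of_nonneg_of_le (fun i => sq_nonneg _) (fun i => ?_)
    (((hS ι b).add (hT ι b)).mul_left 2)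
  have h1 : ‖(S + T) (b i)‖ ≤ ‖S (b i)‖ + ‖T (b i)‖ := norm_add_le _ _
  have h2 := norm_nonneg ((S + T) (b i))
  nlinarith [sq_nonneg (‖S (b i)‖ - ‖T (b i)‖)]

end HS

section Core

variable {E K : Type} [NormedAddCommGroup E] [InnerProductSpace ℝ E] [CompleteSpace E]
    [NormedAddCommGroup K] [InnerProductSpace ℝ K] [CompleteSpace K]

lemma dense_of_adj (A B : K →L[ℝ] K) (hAB : ∀ x y, ⟪A x, y⟫_ℝ = ⟪x, B y⟫_ℝ)
    (hB : ∀ x, B x = 0 → x = 0) : DenseRange A := by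
  have h : (LinearMap.range A.toLinearMap)ᗮ = ⊥ := by
    rw [eq_bot_iff]
    intro y hy
    rw [Submodule.mem_orthogonal] at hy
    have : ⟪A (B y), y⟫_ℝ = 0 := hy _ ⟨B y, rfl⟩
    rw [hAB] at this
    exact hB _ (inner_self_eq_zero.1 this)
  have h2 := (Submodule.dense_iff_topologicalClosure_eq_top).2
    ((Submodule.topologicalClosure_eq_top_iff).2 h)
  simpa [DenseRange] using! h2

/-- Existence of the unitary `V : K → (range ι)^⊥` with `J ι = - ι D + V Q`. -/
lemma exists_V (i : K →L[ℝ] E) (P : E →L[ℝ] K) (J : E →L[ℝ] E) (D Q : K →L[ℝ] K)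
    (hPi : ∀ h, P (i h) = h) (hPadj : ∀ x h, ⟪P x, h⟫_ℝ = ⟪x, i h⟫_ℝ)
    (hJJ : ∀ x, J (J x) = -x) (hJ : ∀ x y, ⟪J x, y⟫_ℝ = -⟪x, J y⟫_ℝ)
    (hD : ∀ h, P (J (i h)) = - D h)
    (hQsym : ∀ h k, ⟪Q h, k⟫_ℝ = ⟪h, Q k⟫_ℝ)
    (hQsq : ∀ h, Q (Q h) = h + D (D h))
    (hcyc : ∀ A : E →L[ℝ] E, (∀ h, A (i h) = 0) → (∀ h, A (J (i h)) = 0) → A = 0)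
    (hsep : ∀ h k, i h = J (i k) → h = 0) :
    DenseRange Q ∧ ∃ (V : K →L[ℝ] E) (W : E →L[ℝ] K), (∀ k, J (i k) = - i (D k) + V (Q k)) ∧
      (∀ y, P (V y) = 0) ∧ (∀ y, W (V y) = y) ∧ (∀ h, W (i h) = 0) ∧
      (∀ x, x = i (P x) + V (W x)) := by
  have hii : ∀ h k, ⟪i h, i k⟫_ℝ = ⟪h, k⟫_ℝ := fun h k => by rw [← hPadj, hPi]
  have hDsk : ∀ h k, ⟪D h, k⟫_ℝ = - ⟪h, D k⟫_ℝ := by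
    intro h k
    have h1 := hPadj (J (i h)) k
    have h2 := hPadj (J (i k)) h
    rw [hD, inner_neg_left] at h1 h2
    rw [hJ] at h1
    have h3 := real_inner_comm (D k) h
    have h4 := real_inner_comm (i h) (J (i k))
    linarith
  let f : K →L[ℝ] E := J.comp i + i.comp D
  have hfn : ∀ k, ‖f k‖ = ‖Q k‖ := by
    intro k
    rw [← sq_eq_sq₀ (norm_nonneg _) (norm_nonneg _), ← real_inner_self_eq_norm_sq,
      ← real_inner_self_eq_norm_sq, hQsym, hQsq]
    change ⟪J (i k) + i (D k), J (i k) + i (D k)⟫_ℝ = _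
    have h1 : ⟪J (i k), J (i k)⟫_ℝ = ⟪k, k⟫_ℝ := by rw [hJ, hJJ, inner_neg_right, hii]; ring
    have h2 : ⟪J (i k), i (D k)⟫_ℝ = -⟪D k, D k⟫_ℝ := by
      rw [← hPadj, hD, inner_neg_left]
    rw [inner_add_left, inner_add_right, inner_add_right, real_inner_comm (J (i k)) (i (D k)),
      h1, h2, hii, inner_add_right]
    have := hDsk k (D k)
    linarith
  have hQinj : ∀ k, Q k = 0 → k = 0 := by
    intro k hk
    have : f k = 0 := by rw [← norm_eq_zero, hfn, hk, norm_zero]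
    have h1 : J (i k) + i (D k) = 0 := this
    have h2 : i (-(D k)) = J (i k) := by
      rw [map_neg]; exact (eq_neg_of_add_eq_zero_left h1).symm
    have h3 := hsep _ _ h2
    rw [h3, map_zero] at h2
    have h4 : J (J (i k)) = 0 := by rw [← h2, map_zero]
    rw [hJJ, neg_eq_zero] at h4
    rw [← hPi k, h4, map_zero]
  have hdense : DenseRange Q := dense_of_adj Q Q hQsym hQinj
  refine ⟨hdense, ?_⟩
  let V : K →L[ℝ] E := f.toLinearMap.extendOfNorm Q.toLinearMap
  have hVQ : ∀ k, V (Q k) = J (i k) + i (D k) := fun k =>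
    LinearMap.extendOfNorm_eq (f := f.toLinearMap) (e := Q.toLinearMap) hdense
      ⟨1, fun x => by rw [one_mul]; exact (hfn x).le⟩ k
  have hVn : ∀ y, ‖V y‖ = ‖y‖ := by
    refine fun y => hdense.induction_on y (isClosed_eq (by fun_prop) (by fun_prop)) ?_
    intro k
    rw [hVQ]; exact hfn k
  have hPV : ∀ y, P (V y) = 0 := by
    refine fun y => hdense.induction_on y (isClosed_eq (by fun_prop) (by fun_prop)) ?_
    intro k
    rw [hVQ, map_add, hD, hPi, neg_add_cancel]
  let W := ContinuousLinearMap.adjoint V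
  have hWV : ∀ y, W (V y) = y := by
    intro y
    have := (ContinuousLinearMap.norm_map_iff_adjoint_comp_self V).1 hVn
    exact DFunLike.congr_fun this y
  have hWi : ∀ h, W (i h) = 0 := by
    intro h
    apply ext_inner_right ℝ
    intro v
    rw [ContinuousLinearMap.adjoint_inner_left, inner_zero_left, real_inner_comm, ← hPadj, hPV,
      inner_zero_left]
  refine ⟨V, W, fun k => by rw [hVQ]; abel, hPV, hWV, hWi, fun x => ?_⟩
  have := hcyc (ContinuousLinearMap.id ℝ E - (i.comp P + V.comp W)) (fun h => ?_) (fun h => ?_)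
  · have := DFunLike.congr_fun this x
    exact sub_eq_zero.1 this
  · simp [hPi, hWi]
  · have hk : J (i h) = - i (D h) + V (Q h) := by rw [hVQ]; abel
    simp [hk, hPi, hWi, hPV, hWV]

theorem core (i : K →L[ℝ] E) (P : E →L[ℝ] K) (J : E →L[ℝ] E) (D Q X : K →L[ℝ] K)
    (hPi : ∀ h, P (i h) = h) (hPadj : ∀ x h, ⟪P x, h⟫_ℝ = ⟪x, i h⟫_ℝ)
    (hJJ : ∀ x, J (J x) = -x) (hJ : ∀ x y, ⟪J x, y⟫_ℝ = -⟪x, J y⟫_ℝ)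
    (hD : ∀ h, P (J (i h)) = - D h)
    (hQsym : ∀ h k, ⟪Q h, k⟫_ℝ = ⟪h, Q k⟫_ℝ)
    (hQsq : ∀ h, Q (Q h) = h + D (D h))
    (hQD : ∀ h, Q (D h) = D (Q h))
    (hcyc : ∀ A : E →L[ℝ] E, (∀ h, A (i h) = 0) → (∀ h, A (J (i h)) = 0) → A = 0)
    (hsep : ∀ h k, i h = J (i k) → h = 0)
    (hDinj : ∀ h, D h = 0 → h = 0) :
    ((∃ S : E →L[ℝ] E, IsHS S ∧
        ∀ (a c : K) (b d : E), P (J b) = 0 → P (J d) = 0 →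
          J (i a + b) = i c + d → S (i a + b) = i (X c) - J (i (X a)))
      ↔
      ((∃ S₁ : K →L[ℝ] K, IsHS S₁ ∧ ∀ u, S₁ (D u) = X u + D (X (D u))) ∧
       (∃ S₂ : K →L[ℝ] K, IsHS S₂ ∧ ∀ u, S₂ (D u) = D (X (Q u))) ∧
       (IsHS (Q.comp X)) ∧
       (∃ S₄ : K →L[ℝ] K, IsHS S₄ ∧ ∀ u, S₄ (D u) = Q (X (Q u))))) := by
  obtain ⟨hQd, V, W, hi, hPV, hWV, hWi, h1⟩ :=
    exists_V i P J D Q hPi hPadj hJJ hJ hD hQsym hQsq hcyc hsep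
  have hDd : DenseRange D := by
    have hDsk : ∀ h k, ⟪D h, k⟫_ℝ = ⟪h, (-D) k⟫_ℝ := by
      intro h k
      have h1 := hPadj (J (i h)) k
      have h2 := hPadj (J (i k)) h
      rw [hD, inner_neg_left] at h1 h2
      rw [hJ] at h1
      have h3 := real_inner_comm (D k) h
      have h4 := real_inner_comm (i h) (J (i k))
      simp only [neg_apply, inner_neg_right]
      linarith
    exact dense_of_adj D (-D) hDsk (fun x hx => hDinj x (by simpa using hx))
  have hJV : ∀ y, J (V y) = - i (Q y) + V (D y) := by
    refine fun y => hQd.induction_on y (isClosed_eq (by fun_prop) (by fun_prop)) ?_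
    intro k
    have e1 : V (Q k) = J (i k) + i (D k) := by rw [hi]; abel
    rw [e1, map_add, hJJ, hi, hQsq, map_add, hQD]; abel
  constructor
  · rintro ⟨S, hS, h⟩
    have hSD : ∀ u, S (i (D u)) = i (X u) + i (D (X (D u))) - V (Q (X (D u))) := by
      intro u
      have := h (D u) u 0 (J (i (D u)) - i u) (by simp)
        (by simp [hJJ, hD, hPi]) (by simp)
      rw [add_zero] at this
      rw [this, hi]; abel
    have hSV : ∀ u, S (V (D u)) = i (D (X (Q u))) - V (Q (X (Q u))) := by
      intro u
      have := h (Q u) 0 (-(i (Q u)) + V (D u)) (J (V (D u)))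
        (by simp [hJV, hD, hPi, hPV, hQD]) (by simp [hJJ, hPV]) (by simp)
      rw [add_neg_cancel_left] at this
      rw [this, hi, map_zero, map_zero]; abel
    refine ⟨⟨P.comp (S.comp i), hs_comp_left (hs_comp_right hS i) P, fun u => ?_⟩,
      ⟨P.comp (S.comp V), hs_comp_left (hs_comp_right hS V) P, fun u => ?_⟩, ?_,
      ⟨-(W.comp (S.comp V)), hs_neg (hs_comp_left (hs_comp_right hS V) W), fun u => ?_⟩⟩
    · simp [hSD, hPi, hPV]
    · simp [hSV, hPi, hPV]
    · have : Q.comp X = -(W.comp (S.comp i)) := by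
        ext y
        refine hDd.induction_on y (isClosed_eq (by fun_prop) (by fun_prop)) ?_
        intro u
        simp [hSD, hWi, hWV]
      rw [this]
      exact hs_neg (hs_comp_left (hs_comp_right hS i) W)
    · simp [hSV, hWi, hWV]
  · rintro ⟨⟨S₁, hS₁, h₁⟩, ⟨S₂, hS₂, h₂⟩, h₃, ⟨S₄, hS₄, h₄⟩⟩
    refine ⟨i.comp (S₁.comp P) + i.comp (S₂.comp W) + -(V.comp ((Q.comp X).comp P))
      + -(V.comp (S₄.comp W)), ?_, ?_⟩
    · exact hs_add (hs_add (hs_add (hs_comp_left (hs_comp_right hS₁ P) i)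
        (hs_comp_left (hs_comp_right hS₂ W) i))
        (hs_neg (hs_comp_left (hs_comp_right h₃ P) V)))
        (hs_neg (hs_comp_left (hs_comp_right hS₄ W) V))
    · intro a c b d hb hd he
      obtain ⟨x, y, rfl⟩ : ∃ x y, b = i x + V y := ⟨_, _, h1 b⟩
      have hxy : D x = - Q y := by
        rw [map_add, hJV, hi] at hb
        simp [hPi, hPV] at hb
        have : -(D x) = Q y := by simpa [sub_eq_zero, add_neg_eq_zero] using hb
        rw [← this, neg_neg]
      have hc : D c = a + x := by
        have e : P (J (J (i a + (i x + V y)))) = P (J (i c + d)) := by rw [he]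
        rw [hJJ, map_add J, map_add P, hd, hD] at e
        simp [hPi, hPV] at e
        have e2 := congrArg Neg.neg e
        simpa [add_comm] using e2.symm
      have ha : a = D c - x := by rw [hc]; abel
      have hy : y = D (-(Q x) - D y) := by
        have := hQsq y
        rw [map_sub, map_neg, ← hQD, hxy, map_neg, this]; abel
      have hq : Q (-(Q x) - D y) = -x := by
        rw [map_sub, map_neg, hQsq, hQD, hxy]
        have : D (Q y) = - D (D x) := by rw [hxy, map_neg, neg_neg]
        rw [map_neg, this]; abel
      have hS2 : S₂ y = -(D (X x)) := by
        conv_lhs => rw [hy]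
        rw [h₂, hq]; simp
      have hS4 : S₄ y = -(Q (X x)) := by
        conv_lhs => rw [hy]
        rw [h₄, hq]; simp
      have hPe : P (i a + (i x + V y)) = D c := by simp [hPi, hPV, hc]
      have hWe : W (i a + (i x + V y)) = y := by simp [hWi, hWV]
      simp only [add_apply, neg_apply,
        ContinuousLinearMap.comp_apply, hPe, hWe, hS2, hS4, h₁]
      rw [hi, ha]
      simp only [map_sub, map_add, map_neg]
      abel

theorem core2 (D Q X : K →L[ℝ] K) (hQD : ∀ h, Q (D h) = D (Q h))
    (hR : ∃ S : K →L[ℝ] K, IsHS S ∧ ∀ u, S (D u) = X u) :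
      ((∃ S₁ : K →L[ℝ] K, IsHS S₁ ∧ ∀ u, S₁ (D u) = X u + D (X (D u))) ∧
       (∃ S₂ : K →L[ℝ] K, IsHS S₂ ∧ ∀ u, S₂ (D u) = D (X (Q u))) ∧
       (IsHS (Q.comp X)) ∧
       (∃ S₄ : K →L[ℝ] K, IsHS S₄ ∧ ∀ u, S₄ (D u) = Q (X (Q u)))) := by
  obtain ⟨R, hR, h⟩ := hR
  refine ⟨⟨R + D.comp (R.comp D), hs_add hR (hs_comp_left (hs_comp_right hR D) D), ?_⟩,
    ⟨D.comp (R.comp Q), hs_comp_left (hs_comp_right hR Q) D, ?_⟩, ?_,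
    ⟨Q.comp (R.comp Q), hs_comp_left (hs_comp_right hR Q) Q, ?_⟩⟩
  · intro u; simp [h]
  · intro u; simp [h, hQD]
  · have : X = R.comp D := by ext u; simp [h]
    rw [this]
    exact hs_comp_left (hs_comp_right hR D) Q
  · intro u; simp [h, hQD]

end Core

theorem weakly_inner_criterion
    {ℋ : Type} [NormedAddCommGroup ℋ] [InnerProductSpace ℂ ℋ] [CompleteSpace ℋ]
    (H : Submodule ℝ ℋ) (hH : IsClosed (H : Set ℋ))
    (hcyc : Dense ((H ⊔ H.map (mulI ℋ) : Submodule ℝ ℋ) : Set ℋ))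
    (hsep : H ⊓ H.map (mulI ℋ) = ⊥)
    (hfac : H ⊓ sympComp H = ⊥)
    (D Q : ↥H →L[ℝ] ↥H)
    (hD : ∀ h k : ↥H, (⟪(h : ℋ), (k : ℋ)⟫_ℂ).im = ⟪(h : ℋ), ((D k : ↥H) : ℋ)⟫_ℝ)
    (hQsym : ∀ h k : ↥H, ⟪((Q h : ↥H) : ℋ), (k : ℋ)⟫_ℝ = ⟪(h : ℋ), ((Q k : ↥H) : ℋ)⟫_ℝ)
    (hQpos : ∀ h : ↥H, 0 ≤ ⟪(h : ℋ), ((Q h : ↥H) : ℋ)⟫_ℝ)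
    (hQsq : ∀ h : ↥H, Q (Q h) = h + D (D h))
    (hQD : ∀ h : ↥H, Q (D h) = D (Q h))
    (X : ↥H →L[ℝ] ↥H)
    -- T = 1 + X is a symplectic bijection of H
    (hTbij : Function.Bijective fun h : ↥H => h + X h)
    (hTsymp : ∀ h k : ↥H,
      (⟪((h + X h : ↥H) : ℋ), ((k + X k : ↥H) : ℋ)⟫_ℂ).im = (⟪(h : ℋ), (k : ℋ)⟫_ℂ).im) :
    -- [T̂, i] ∈ ℒ²(ℋ) iff the four operators are in ℒ²(H)
    ((∃ S : ℋ →L[ℝ] ℋ, IsHS S ∧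
        ∀ (a c : ↥H) (b d : ℋ), b ∈ sympComp H → d ∈ sympComp H →
          Complex.I • ((a : ℋ) + b) = (c : ℋ) + d →
          S ((a : ℋ) + b) = ((X c : ↥H) : ℋ) - Complex.I • ((X a : ↥H) : ℋ))
      ↔
      ((∃ S₁ : ↥H →L[ℝ] ↥H, IsHS S₁ ∧      -- X D⁻¹ + D X ∈ ℒ²(H)
          ∀ u : ↥H, S₁ (D u) = X u + D (X (D u))) ∧
       (∃ S₂ : ↥H →L[ℝ] ↥H, IsHS S₂ ∧      -- D X D⁻¹ √(1+D²) ∈ ℒ²(H)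
          ∀ u : ↥H, S₂ (D u) = D (X (Q u))) ∧
       (IsHS (Q.comp X)) ∧                  -- √(1+D²) X ∈ ℒ²(H)
       (∃ S₄ : ↥H →L[ℝ] ↥H, IsHS S₄ ∧      -- √(1+D²) X D⁻¹ √(1+D²) ∈ ℒ²(H)
          ∀ u : ↥H, S₄ (D u) = Q (X (Q u))))) ∧
    -- in particular, X D⁻¹ ∈ ℒ²(H) implies [T̂, i] ∈ ℒ²(ℋ)
    ((∃ S : ↥H →L[ℝ] ↥H, IsHS S ∧ ∀ u : ↥H, S (D u) = X u) →
      (∃ S : ℋ →L[ℝ] ℋ, IsHS S ∧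
        ∀ (a c : ↥H) (b d : ℋ), b ∈ sympComp H → d ∈ sympComp H →
          Complex.I • ((a : ℋ) + b) = (c : ℋ) + d →
          S ((a : ℋ) + b) = ((X c : ↥H) : ℋ) - Complex.I • ((X a : ↥H) : ℋ))) := by
  haveI : CompleteSpace ↥H := hH.completeSpace_coe
  let J : ℋ →L[ℝ] ℋ := (Complex.I • ContinuousLinearMap.id ℂ ℋ).restrictScalars ℝ
  let i : ↥H →L[ℝ] ℋ := H.subtypeL
  let P : ℋ →L[ℝ] ↥H := ContinuousLinearMap.adjoint i
  have hJa : ∀ x, J x = Complex.I • x := fun x => rfl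
  have hia : ∀ h : ↥H, i h = (h : ℋ) := fun h => rfl
  have hre : ∀ x y : ℋ, ⟪x, y⟫_ℝ = (⟪x, y⟫_ℂ).re := fun x y => rfl
  have hPadj : ∀ x h, ⟪P x, h⟫_ℝ = ⟪x, i h⟫_ℝ := fun x h =>
    ContinuousLinearMap.adjoint_inner_left i h x
  have hPi : ∀ h, P (i h) = h := by
    intro h
    apply ext_inner_right ℝ
    intro v
    rw [hPadj]; rfl
  have hJJ : ∀ x, J (J x) = -x := by
    intro x
    rw [hJa, hJa, smul_smul, Complex.I_mul_I, neg_one_smul]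
  have hJ : ∀ x y, ⟪J x, y⟫_ℝ = -⟪x, J y⟫_ℝ := by
    intro x y
    rw [hre, hre, hJa, hJa, inner_smul_left, inner_smul_right]
    simp
  have hDP : ∀ h, P (J (i h)) = - D h := by
    intro k
    apply ext_inner_left ℝ
    intro v
    rw [real_inner_comm, hPadj, real_inner_comm, inner_neg_right]
    have h1 := hD v k
    have h2 : ⟪v, D k⟫_ℝ = ⟪(v : ℋ), ((D k : ↥H) : ℋ)⟫_ℝ := rfl
    rw [h2, ← h1, hre, hJa, inner_smul_right, hia, hia]
    simp
  have hcyc' : ∀ A : ℋ →L[ℝ] ℋ, (∀ h, A (i h) = 0) → (∀ h, A (J (i h)) = 0) → A = 0 := by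
    intro A h1 h2
    have hz : (H ⊔ H.map (mulI ℋ) : Submodule ℝ ℋ) ≤ LinearMap.ker A.toLinearMap := by
      refine sup_le ?_ ?_
      · intro x hx
        exact h1 ⟨x, hx⟩
      · rintro _ ⟨x, hx, rfl⟩
        exact h2 ⟨x, hx⟩
    ext x
    refine hcyc.induction (P := fun x => A x = (0 : ℋ →L[ℝ] ℋ) x) (fun y hy => hz hy)
      (isClosed_eq (by fun_prop) (by fun_prop)) x
  have hsep' : ∀ h k, i h = J (i k) → h = 0 := by
    intro h k e
    have : (h : ℋ) ∈ H ⊓ H.map (mulI ℋ) := ⟨h.2, k, k.2, e.symm⟩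
    rw [hsep] at this
    exact Subtype.ext this
  have hmem : ∀ b : ℋ, b ∈ sympComp H ↔ P (J b) = 0 := by
    intro b
    constructor
    · intro hb
      apply ext_inner_right ℝ
      intro v
      have h1 : ⟪J (i v), b⟫_ℝ = 0 :=
        (Submodule.mem_orthogonal _ _).1 hb _ ⟨(v : ℋ), v.2, rfl⟩
      rw [hPadj, hJ, inner_zero_left, real_inner_comm, h1, neg_zero]
    · intro hb
      refine (Submodule.mem_orthogonal _ _).2 ?_
      rintro _ ⟨x, hx, rfl⟩
      have h1 : ⟪J (i ⟨x, hx⟩), b⟫_ℝ = 0 := by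
        rw [real_inner_comm, ← neg_neg ⟪b, _⟫_ℝ, ← hJ, ← hPadj, hb, inner_zero_left, neg_zero]
      exact h1
  have hDinj : ∀ h, D h = 0 → h = 0 := by
    intro h e
    have : (h : ℋ) ∈ H ⊓ sympComp H := ⟨h.2, (hmem _).2 (by
      have := hDP h
      rw [e, neg_zero] at this
      exact this)⟩
    rw [hfac] at this
    exact Subtype.ext this
  have hmain := core i P J D Q X hPi hPadj hJJ hJ hDP hQsym hQsq hQD hcyc' hsep' hDinj
  simp only [← hmem] at hmain
  exact ⟨hmain, fun h => hmain.2 (core2 D Q X hQD h)⟩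
end
end
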